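/- Let H : ℝ² → ℝ be real-analytic in a neighborhood of the origin, with H(0,0) = 0, the origin an isolated critical point of H that is not a local extremum. Then for all sufficiently small ρ > 0 the following holds: for every connected component S of B_ρ ∖ {H = 0} (a separatrix sector) there exists h₀ > 0 such that for every h ∈ (0, h₀) the level set C_h = {p ∈ S : |H(p)| = h} is connected and intersects the boundary circle ∂B_ρ in exactly two points. -/

import Mathlib

/-- The closed Euclidean ball of radius `ρ` centered at the origin of `ℝ²`. -/
def euclBall (ρ : ℝ) : Set (ℝ × ℝ) := {p | p.1 ^ 2 + p.2 ^ 2 ≤ ρ ^ 2}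

/-- The boundary circle of `euclBall ρ`. -/
def euclCircle (ρ : ℝ) : Set (ℝ × ℝ) := {p | p.1 ^ 2 + p.2 ^ 2 = ρ ^ 2}

/-- The separatrix sector of `H` in `B_ρ` containing `x₀`: the connected component of
`B_ρ ∩ {H ≠ 0}` containing `x₀`. -/
def sector (H : ℝ × ℝ → ℝ) (ρ : ℝ) (x₀ : ℝ × ℝ) : Set (ℝ × ℝ) :=
  connectedComponentIn {p ∈ euclBall ρ | H p ≠ 0} x₀

open Filter Topology

/-- The linear map `(x, y) ↦ (x, t * y)`. -/
noncomputable def scaleSnd (t : ℝ) : ℝ × ℝ →L[ℝ] ℝ × ℝ :=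
  (ContinuousLinearMap.fst ℝ ℝ ℝ).prod (t • ContinuousLinearMap.snd ℝ ℝ ℝ)

@[simp] lemma scaleSnd_apply (t : ℝ) (p : ℝ × ℝ) : scaleSnd t p = (p.1, t * p.2) := rfl

lemma continuous_scaleSnd : Continuous scaleSnd := by
  have h : scaleSnd = fun t : ℝ => (ContinuousLinearMap.inl ℝ ℝ ℝ) ∘L
      (ContinuousLinearMap.fst ℝ ℝ ℝ) + t • ((ContinuousLinearMap.inr ℝ ℝ ℝ) ∘L
      (ContinuousLinearMap.snd ℝ ℝ ℝ)) := by
    funext t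
    ext <;> simp
  rw [h]
  fun_prop

lemma norm_scaleSnd_apply_le {t : ℝ} (ht : t ∈ Set.Icc (0 : ℝ) 1) (p : ℝ × ℝ) :
    ‖scaleSnd t p‖ ≤ ‖p‖ := by
  simp only [scaleSnd_apply, Prod.norm_def, norm_mul]
  gcongr
  rw [Real.norm_of_nonneg ht.1]
  exact mul_le_of_le_one_left (norm_nonneg _) ht.2

lemma norm_scaleSnd_le {t : ℝ} (ht : t ∈ Set.Icc (0 : ℝ) 1) : ‖scaleSnd t‖ ≤ 1 :=
  ContinuousLinearMap.opNorm_le_bound _ zero_le_one fun p => by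
    simpa using norm_scaleSnd_apply_le ht p

lemma AnalyticAt.integral_scaleSnd {k : ℝ × ℝ → ℝ} (hk : AnalyticAt ℝ k 0) :
    AnalyticAt ℝ (fun p => ∫ t in (0 : ℝ)..1, k (scaleSnd t p)) 0 := by
  obtain ⟨P, R, hP⟩ := hk
  let A : (n : ℕ) → ℝ → ContinuousMultilinearMap ℝ (fun _ : Fin n => ℝ × ℝ) ℝ :=
    fun n t => (P n).compContinuousLinearMap fun _ => scaleSnd t
  have hA : ∀ n, Continuous (A n) := by
    intro n
    have h1 : Continuous fun t : ℝ => (fun _ : Fin n => scaleSnd t) :=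
      continuous_pi fun _ => continuous_scaleSnd
    have h2 := (ContinuousMultilinearMap.compContinuousLinearMapContinuousMultilinear ℝ
      (fun _ : Fin n => ℝ × ℝ) (fun _ : Fin n => ℝ × ℝ) ℝ).cont.comp h1
    exact h2.clm_apply continuous_const
  have hAn : ∀ n, ∀ t ∈ Set.Icc (0 : ℝ) 1, ‖A n t‖ ≤ ‖P n‖ := by
    intro n t ht
    refine (ContinuousMultilinearMap.norm_compContinuousLinearMap_le _ _).trans ?_
    refine mul_le_of_le_one_right (norm_nonneg _) ?_
    exact Finset.prod_le_one (fun _ _ => norm_nonneg _) fun _ _ => norm_scaleSnd_le ht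
  have hsub : ∀ t : ℝ, t ∈ Set.uIoc (0 : ℝ) 1 → t ∈ Set.Icc (0 : ℝ) 1 := fun t ht => by
    rw [Set.uIoc_of_le zero_le_one] at ht
    exact Set.Ioc_subset_Icc_self ht
  let Q : FormalMultilinearSeries ℝ (ℝ × ℝ) ℝ := fun n => ∫ t in (0 : ℝ)..1, A n t
  have hQ : ∀ n, ‖Q n‖ ≤ ‖P n‖ := by
    intro n
    have := intervalIntegral.norm_integral_le_of_norm_le_const (a := (0 : ℝ)) (b := 1)
      (f := A n) (C := ‖P n‖) fun t ht => hAn n t (hsub t ht)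
    simpa using this
  have hQapp : ∀ n (v : Fin n → ℝ × ℝ), Q n v = ∫ t in (0 : ℝ)..1, A n t v := by
    intro n v
    exact ((ContinuousMultilinearMap.apply ℝ (fun _ : Fin n => ℝ × ℝ) ℝ
      v).intervalIntegral_comp_comm ((hA n).intervalIntegrable 0 1)).symm
  refine ⟨Q, R, ?_, hP.r_pos, ?_⟩
  · refine hP.r_le.trans (ENNReal.le_of_forall_nnreal_lt fun r hr => ?_)
    obtain ⟨C, hC, h⟩ := P.norm_mul_pow_le_of_lt_radius hr
    exact Q.le_radius_of_bound C fun n =>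
      (mul_le_mul_of_nonneg_right (hQ n) (by positivity)).trans (h n)
  · intro y hy
    have hsum : Summable fun n => ‖P n‖ * ‖y‖ ^ n := by
      have : (‖y‖₊ : ENNReal) < P.radius := by
        refine lt_of_lt_of_le ?_ hP.r_le
        simpa [enorm] using hy
      simpa using P.summable_norm_mul_pow this
    simp only [hQapp, zero_add]
    refine intervalIntegral.hasSum_integral_of_dominated_convergence
      (fun n _ => ‖P n‖ * ‖y‖ ^ n) ?_ ?_ ?_ ?_ ?_
    · intro n
      exact ((ContinuousMultilinearMap.apply ℝ (fun _ : Fin n => ℝ × ℝ) ℝ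
        (fun _ => y)).continuous.comp (hA n)).aestronglyMeasurable
    · intro n
      refine Eventually.of_forall fun t ht => ?_
      refine ((A n t).le_opNorm _).trans ?_
      simp only [Finset.prod_const, Finset.card_univ, Fintype.card_fin]
      gcongr
      exact hAn n t (hsub t ht)
    · exact Eventually.of_forall fun _ _ => hsum
    · exact intervalIntegrable_const
    · refine Eventually.of_forall fun t ht => ?_
      have hmem : scaleSnd t y ∈ Metric.eball (0 : ℝ × ℝ) R := by
        have : ‖scaleSnd t y‖ₑ ≤ ‖y‖ₑ := by
          rw [enorm_le_iff_norm_le]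
          exact norm_scaleSnd_apply_le (hsub t ht) y
        simp only [Metric.mem_eball, edist_zero_right] at hy ⊢
        exact this.trans_lt hy
      have := hP.hasSum hmem
      simpa [A] using this

/-- Partial derivative in the second variable. -/
noncomputable def dSnd (f : ℝ × ℝ → ℝ) (p : ℝ × ℝ) : ℝ := fderiv ℝ f p (0, 1)

lemma AnalyticAt.dSnd {f : ℝ × ℝ → ℝ} {p : ℝ × ℝ} (hf : AnalyticAt ℝ f p) :
    AnalyticAt ℝ (dSnd f) p := by
  have h := hf.fderiv
  exact ((ContinuousLinearMap.apply ℝ ℝ ((0, 1) : ℝ × ℝ)).analyticAt _).comp h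

/-- Division of an analytic function by the second coordinate. -/
lemma AnalyticAt.exists_eq_add_snd_mul {f : ℝ × ℝ → ℝ} (hf : AnalyticAt ℝ f 0) :
    ∃ G : ℝ × ℝ → ℝ, AnalyticAt ℝ G 0 ∧ ∀ᶠ p in 𝓝 (0 : ℝ × ℝ),
      f p = f (p.1, 0) + p.2 * G p := by
  refine ⟨_, hf.dSnd.integral_scaleSnd, ?_⟩
  obtain ⟨ε, hε, hball⟩ := Metric.eventually_nhds_iff_ball.mp hf.eventually_analyticAt
  filter_upwards [Metric.ball_mem_nhds _ hε] with p hp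
  have hmem : ∀ t ∈ Set.Icc (0 : ℝ) 1, scaleSnd t p ∈ Metric.ball (0 : ℝ × ℝ) ε := by
    intro t ht
    rw [mem_ball_zero_iff] at hp ⊢
    exact (norm_scaleSnd_apply_le ht p).trans_lt hp
  have hder : ∀ t ∈ Set.uIcc (0 : ℝ) 1,
      HasDerivAt (fun t => f (scaleSnd t p)) (p.2 * _root_.dSnd f (scaleSnd t p)) t := by
    intro t ht
    rw [Set.uIcc_of_le zero_le_one] at ht
    have h1 := (hball _ (hmem t ht)).differentiableAt.hasFDerivAt
    have h2 : HasDerivAt (fun t => scaleSnd t p) ((0, p.2) : ℝ × ℝ) t := by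
      simp only [scaleSnd_apply]
      exact (hasDerivAt_const t p.1).prodMk (by simpa using (hasDerivAt_id t).mul_const p.2)
    have h3 := h1.comp_hasDerivAt t h2
    have h4 : ((0, p.2) : ℝ × ℝ) = p.2 • ((0, 1) : ℝ × ℝ) := by simp
    rw [h4, map_smul, smul_eq_mul] at h3
    exact h3
  have hcont : ContinuousOn (fun t => p.2 * _root_.dSnd f (scaleSnd t p)) (Set.uIcc 0 1) := by
    rw [Set.uIcc_of_le zero_le_one]
    intro t ht
    have h1 := (hball _ (hmem t ht)).dSnd.continuousAt
    have h2 : Continuous fun t => scaleSnd t p := continuous_scaleSnd.clm_apply continuous_const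
    exact (continuousAt_const.mul (h1.comp (f := fun t => scaleSnd t p) h2.continuousAt)).continuousWithinAt
  have := intervalIntegral.integral_eq_sub_of_hasDerivAt hder hcont.intervalIntegrable
  rw [intervalIntegral.integral_const_mul] at this
  simp only [scaleSnd_apply, one_mul, zero_mul, Prod.mk.eta] at this ⊢
  linarith

lemma dSnd_eventuallyEq {f g : ℝ × ℝ → ℝ} {p : ℝ × ℝ} (h : f =ᶠ[𝓝 p] g) :
    dSnd f =ᶠ[𝓝 p] dSnd g := by
  filter_upwards [h.fderiv (𝕜 := ℝ)] with q hq
  simp [dSnd, hq]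

lemma AnalyticAt.iterate_dSnd {f : ℝ × ℝ → ℝ} {p : ℝ × ℝ} (hf : AnalyticAt ℝ f p) (j : ℕ) :
    AnalyticAt ℝ (_root_.dSnd^[j] f) p := by
  induction j with
  | zero => simpa
  | succ j ih => rw [Function.iterate_succ_apply']; exact ih.dSnd

lemma hasDerivAt_snd {f : ℝ × ℝ → ℝ} {p : ℝ × ℝ} (hf : DifferentiableAt ℝ f p) :
    HasDerivAt (fun t => f (p.1, t)) (dSnd f p) p.2 := by
  have h2 : HasDerivAt (fun t : ℝ => (p.1, t)) ((0, 1) : ℝ × ℝ) p.2 :=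
    (hasDerivAt_const _ p.1).prodMk (hasDerivAt_id _)
  exact hf.hasFDerivAt.comp_hasDerivAt p.2 h2

lemma AnalyticAt.iterate_dSnd_eq {f : ℝ × ℝ → ℝ} {p : ℝ × ℝ} (hf : AnalyticAt ℝ f p) (j : ℕ) :
    (_root_.dSnd^[j] f) p = iteratedDeriv j (fun t => f (p.1, t)) p.2 := by
  induction j generalizing f with
  | zero => simp
  | succ j ih =>
    rw [Function.iterate_succ_apply, ih hf.dSnd, iteratedDeriv_succ']
    refine Filter.EventuallyEq.iteratedDeriv_eq j ?_
    have hc : Tendsto (fun t : ℝ => (p.1, t)) (𝓝 p.2) (𝓝 p) :=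
      (by fun_prop : Continuous fun t : ℝ => (p.1, t)).tendsto' _ _ rfl
    filter_upwards [hc.eventually hf.eventually_analyticAt] with t ht
    exact (hasDerivAt_snd ht.differentiableAt).deriv.symm

lemma iterate_dSnd_of_eq_add_snd_mul {f G : ℝ × ℝ → ℝ} (hf : AnalyticAt ℝ f 0)
    (hG : AnalyticAt ℝ G 0) (h : ∀ᶠ p in 𝓝 (0 : ℝ × ℝ), f p = f (p.1, 0) + p.2 * G p) (j : ℕ) :
    ∀ᶠ p in 𝓝 (0 : ℝ × ℝ),
      (dSnd^[j + 1] f) p = (j + 1) * (dSnd^[j] G) p + p.2 * (dSnd^[j + 1] G) p := by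
  induction j with
  | zero =>
    have hc : Tendsto (fun p : ℝ × ℝ => (p.1, (0 : ℝ))) (𝓝 0) (𝓝 0) :=
      (by fun_prop : Continuous fun p : ℝ × ℝ => (p.1, (0 : ℝ))).tendsto' _ _ rfl
    filter_upwards [h.eventually_nhds, hG.eventually_analyticAt, hf.eventually_analyticAt]
      with p hp hGp hfp
    have h1 := hasDerivAt_snd hfp.differentiableAt
    have h2 := (hasDerivAt_id p.2).mul (hasDerivAt_snd hGp.differentiableAt)
    have h3 := h2.const_add (f (p.1, 0))
    have hc : Tendsto (fun t : ℝ => (p.1, t)) (𝓝 p.2) (𝓝 p) :=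
      (by fun_prop : Continuous fun t : ℝ => (p.1, t)).tendsto' _ _ rfl
    have h4 := h3.congr_of_eventuallyEq (f₁ := fun t => f (p.1, t)) (by
      filter_upwards [hc.eventually hp] with t ht
      simpa using ht)
    have := h1.unique h4
    simpa using this
  | succ j ih =>
    filter_upwards [dSnd_eventuallyEq ih, (hG.iterate_dSnd j).eventually_analyticAt,
      (hG.iterate_dSnd (j + 1)).eventually_analyticAt] with p hp h1 h2
    rw [Function.iterate_succ_apply', hp]
    have h3 := (hasDerivAt_snd h1.differentiableAt).const_mul ((j : ℝ) + 1)
    have h4 := (hasDerivAt_id p.2).mul (hasDerivAt_snd h2.differentiableAt)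
    have h5 := h3.add h4
    have h6 : DifferentiableAt ℝ (fun p : ℝ × ℝ => ((j : ℝ) + 1) * (dSnd^[j] G) p
        + p.2 * (dSnd^[j + 1] G) p) p :=
      (h1.differentiableAt.const_mul _).add (differentiableAt_snd.mul h2.differentiableAt)
    have h7 := (hasDerivAt_snd h6).unique h5
    rw [h7]
    simp only [Function.iterate_succ_apply', id]
    push_cast
    ring

lemma tendsto_fst_zero : Tendsto (fun p : ℝ × ℝ => (p.1, (0 : ℝ))) (𝓝 0) (𝓝 0) :=
  (by fun_prop : Continuous fun p : ℝ × ℝ => (p.1, (0 : ℝ))).tendsto' _ _ rfl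

/-- Taylor expansion in the second variable with analytic remainder. -/
lemma AnalyticAt.exists_taylor_snd {f : ℝ × ℝ → ℝ} (hf : AnalyticAt ℝ f 0) (d : ℕ) :
    ∃ e : ℝ × ℝ → ℝ, AnalyticAt ℝ e 0 ∧ (_root_.dSnd^[d] f) 0 = d.factorial * e 0 ∧
      ∀ᶠ p in 𝓝 (0 : ℝ × ℝ), f p = ∑ j ∈ Finset.range d,
        (_root_.dSnd^[j] f) (p.1, 0) / j.factorial * p.2 ^ j + p.2 ^ d * e p := by
  induction d generalizing f with
  | zero => exact ⟨f, hf, by simp, by simp⟩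
  | succ d ih =>
    obtain ⟨G, hG, hfG⟩ := hf.exists_eq_add_snd_mul
    obtain ⟨e, he, he0, hGe⟩ := ih hG
    have key := iterate_dSnd_of_eq_add_snd_mul hf hG hfG
    refine ⟨e, he, ?_, ?_⟩
    · rw [(key d).self_of_nhds, he0, Nat.factorial_succ]
      push_cast
      simp
      ring
    · have hall : ∀ᶠ p in 𝓝 (0 : ℝ × ℝ), ∀ j ∈ Finset.range d,
          (_root_.dSnd^[j + 1] f) (p.1, 0) = (j + 1) * (_root_.dSnd^[j] G) (p.1, 0) := by
        rw [Filter.eventually_all_finset]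
        intro j _
        filter_upwards [tendsto_fst_zero.eventually (key j)] with p hp
        simpa using hp
      filter_upwards [hfG, hGe, hall] with p h1 h2 h3
      rw [h1, h2, Finset.sum_range_succ']
      have : ∑ j ∈ Finset.range d, (_root_.dSnd^[j + 1] f) (p.1, 0) / (j + 1).factorial
            * p.2 ^ (j + 1) = p.2 * ∑ j ∈ Finset.range d,
            (_root_.dSnd^[j] G) (p.1, 0) / j.factorial * p.2 ^ j := by
        rw [Finset.mul_sum]
        refine Finset.sum_congr rfl fun j hj => ?_
        rw [h3 j hj, Nat.factorial_succ]
        push_cast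
        have : (j.factorial : ℝ) ≠ 0 := by positivity
        have : (j : ℝ) + 1 ≠ 0 := by positivity
        field_simp
        ring
      rw [this]
      simp only [Function.iterate_zero, id, Nat.factorial_zero, Nat.cast_one, div_one, pow_zero,
        mul_one]
      ring

lemma AnalyticAt.exists_implicit {G : ℝ × ℝ → ℝ} (hG : AnalyticAt ℝ G 0) (h0 : G 0 = 0)
    (h1 : _root_.dSnd G 0 ≠ 0) :
    ∃ τ : ℝ → ℝ, AnalyticAt ℝ τ 0 ∧ τ 0 = 0 ∧ ∀ᶠ r in 𝓝 (0 : ℝ), G (r, τ r) = 0 := by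
  have cdf : ContDiffAt ℝ ⊤ G 0 := hG.contDiffAt
  have if₂ : (fderiv ℝ G 0 ∘L .inr ℝ ℝ ℝ).IsInvertible := by
    refine ⟨ContinuousLinearEquiv.unitsEquivAut ℝ (Units.mk0 _ h1), ?_⟩
    ext
    simp [_root_.dSnd]
  refine ⟨cdf.implicitFunction (by simp) if₂, ?_, cdf.implicitFunction_apply_self (by simp) if₂, ?_⟩
  · exact (cdf.contDiffAt_implicitFunction (by simp) if₂).analyticAt
  · have := cdf.eventually_apply_implicitFunction (by simp) if₂
    rw [h0] at this
    exact this

lemma Polynomial.iteratedDeriv_eval (P : Polynomial ℝ) (j : ℕ) :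
    iteratedDeriv j (fun t => P.eval t) = fun t => (Polynomial.derivative^[j] P).eval t := by
  induction j with
  | zero => simp
  | succ j ih =>
    funext t
    rw [iteratedDeriv_succ, ih, Polynomial.deriv, Function.iterate_succ_apply']

lemma Polynomial.exists_iteratedDeriv_ne_zero {d : ℕ} (hd : 0 < d) {c : ℕ → ℝ} {e : ℝ}
    (he : e ≠ 0) (hc : c (d - 1) = 0) (hex : ∃ j < d, c j ≠ 0) (u : ℝ) :
    ∃ j < d, iteratedDeriv j (fun t => ∑ j ∈ Finset.range d, c j * (u + t) ^ j
      + (u + t) ^ d * e) 0 ≠ 0 := by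
  by_contra! hcon
  let c' : ℕ → ℝ := fun j => if j = d then e else c j
  let P : Polynomial ℝ := ∑ j ∈ Finset.range (d + 1), Polynomial.monomial j (c' j)
  have hcoeff : ∀ j, P.coeff j = if j ≤ d then c' j else 0 := by
    intro j
    simp [P, Polynomial.finsetSum_coeff, Polynomial.coeff_monomial]
  have heval : (fun t => ∑ j ∈ Finset.range d, c j * (u + t) ^ j + (u + t) ^ d * e)
      = fun t => (Polynomial.taylor u P).eval t := by
    funext t
    rw [Polynomial.taylor_eval, Polynomial.eval_finsetSum]
    simp only [Polynomial.eval_monomial, Finset.sum_range_succ]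
    rw [add_comm t u]
    congr 1
    · refine Finset.sum_congr rfl fun j hj => ?_
      rw [Finset.mem_range] at hj
      simp [c', hj.ne]
    · simp [c', mul_comm]
  have hdeg : P.natDegree ≤ d := by
    rw [Polynomial.natDegree_le_iff_coeff_eq_zero]
    intro N hN
    rw [hcoeff, if_neg (by omega)]
  set T := Polynomial.taylor u P with hTdef
  rw [heval] at hcon
  have hlow : ∀ j < d, T.coeff j = 0 := by
    intro j hj
    have := hcon j hj
    rw [Polynomial.iteratedDeriv_eval] at this
    beta_reduce at this
    rw [← Polynomial.coeff_zero_eq_eval_zero, Polynomial.coeff_iterate_derivative] at this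
    simpa [Nat.descFactorial_self, Nat.factorial_ne_zero] using this
  have hTdeg : T.natDegree ≤ d := by rw [hTdef, Polynomial.natDegree_taylor]; exact hdeg
  have hT : T = Polynomial.C (T.coeff d) * Polynomial.X ^ d := by
    ext j
    rw [Polynomial.coeff_C_mul_X_pow]
    rcases lt_trichotomy j d with h | h | h
    · rw [hlow j h, if_neg h.ne]
    · simp [h]
    · rw [if_neg h.ne', Polynomial.coeff_eq_zero_of_natDegree_lt (hTdeg.trans_lt h)]
  have hP : P = Polynomial.C (T.coeff d) * (Polynomial.X + Polynomial.C (-u)) ^ d := by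
    apply Polynomial.taylor_injective u
    rw [← hTdef, Polynomial.taylor_mul, Polynomial.taylor_C, Polynomial.taylor_pow]
    simpa using hT
  have hPc : ∀ j, P.coeff j = T.coeff d * ((-u) ^ (d - j) * d.choose j) := by
    intro j
    conv_lhs => rw [hP]
    rw [Polynomial.coeff_C_mul, Polynomial.coeff_X_add_C_pow]
  have h1 : T.coeff d = e := by
    have := hPc d
    rw [hcoeff] at this
    simpa [c'] using this.symm
  have h2 : u = 0 := by
    have := hPc (d - 1)
    rw [hcoeff, if_pos (by omega), h1] at this
    have hne : d - 1 ≠ d := by omega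
    have h3 : d - (d - 1) = 1 := by omega
    have h4 : d.choose (d - 1) ≠ 0 := (Nat.choose_pos (by omega)).ne'
    simpa [c', hne, hc, h3, h4, he] using this
  obtain ⟨j, hj, hcj⟩ := hex
  apply hcj
  have := hPc j
  rw [hcoeff, if_pos hj.le, h2] at this
  have h3 : d - j ≠ 0 := by omega
  simpa [c', hj.ne, h3] using this

lemma exists_newton_slope {d : ℕ} {a : ℕ → ℝ → ℝ} (ha : ∀ j < d, AnalyticAt ℝ (a j) 0)
    (h0 : ∀ j < d, a j 0 = 0) (hex : ∃ j < d, ¬ ∀ᶠ r in 𝓝 (0 : ℝ), a j r = 0) :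
    ∃ p q : ℕ, 0 < p ∧ 0 < q ∧ ∃ b : ℕ → ℝ → ℝ, (∀ j < d, AnalyticAt ℝ (b j) 0) ∧
      (∀ j < d, ∀ᶠ s in 𝓝 (0 : ℝ), a j (s ^ q) = s ^ (p * (d - j)) * b j s) ∧
      (∃ j < d, b j 0 ≠ 0) ∧ (∀ j < d, (∀ᶠ r in 𝓝 (0 : ℝ), a j r = 0) → b j 0 = 0) := by
  classical
  have hfac : ∀ j, ∃ (n : ℕ) (g : ℝ → ℝ), j < d → (¬ ∀ᶠ r in 𝓝 (0 : ℝ), a j r = 0) →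
      AnalyticAt ℝ g 0 ∧ g 0 ≠ 0 ∧ ∀ᶠ r in 𝓝 (0 : ℝ), a j r = r ^ n * g r := by
    intro j
    by_cases hj : j < d ∧ ¬ ∀ᶠ r in 𝓝 (0 : ℝ), a j r = 0
    · obtain ⟨n, g, h⟩ := (ha j hj.1).exists_eventuallyEq_pow_smul_nonzero_iff.mpr hj.2
      exact ⟨n, g, fun _ _ => by simpa using h⟩
    · exact ⟨0, 0, fun h1 h2 => (hj ⟨h1, h2⟩).elim⟩
  choose n g hng using hfac
  let J := (Finset.range d).filter fun j => ¬ ∀ᶠ r in 𝓝 (0 : ℝ), a j r = 0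
  have hJ : J.Nonempty := by
    obtain ⟨j, hj, hj'⟩ := hex
    exact ⟨j, by simp only [J, Finset.mem_filter, Finset.mem_range]; exact ⟨hj, hj'⟩⟩
  obtain ⟨k, hk, hmin⟩ := J.exists_min_image (fun j => (n j : ℚ) / ((d - j : ℕ) : ℚ)) hJ
  simp only [J, Finset.mem_filter, Finset.mem_range] at hk hmin
  obtain ⟨hga, hg0, hgk⟩ := hng k hk.1 hk.2
  have hnk : 0 < n k := by
    rw [Nat.pos_iff_ne_zero]
    intro h
    have := hgk.self_of_nhds
    rw [h0 k hk.1, h] at this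
    exact hg0 (by simpa using this.symm)
  have hle : ∀ j < d, (¬ ∀ᶠ r in 𝓝 (0 : ℝ), a j r = 0) → n k * (d - j) ≤ n j * (d - k) := by
    intro j hj hj'
    have := hmin j ⟨hj, hj'⟩
    have h1 : (0 : ℚ) < ((d - k : ℕ) : ℚ) := by have := hk.1; exact_mod_cast (by omega)
    have h2 : (0 : ℚ) < ((d - j : ℕ) : ℚ) := by exact_mod_cast (by omega)
    rw [div_le_div_iff₀ h1 h2] at this
    exact_mod_cast this
  have hq : 0 < d - k := by have := hk.1; omega
  have hpow : ∀ m : ℕ, AnalyticAt ℝ (fun s : ℝ => s ^ m) 0 := fun m => analyticAt_id.pow m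
  have htend : Tendsto (fun s : ℝ => s ^ (d - k)) (𝓝 0) (𝓝 0) :=
    (continuous_pow (d - k)).tendsto' _ _ (by simp [hq.ne'])
  refine ⟨n k, d - k, hnk, hq, fun j => if ∀ᶠ r in 𝓝 (0 : ℝ), a j r = 0 then fun _ => 0 else
    fun s => s ^ (n j * (d - k) - n k * (d - j)) * g j (s ^ (d - k)), ?_, ?_, ?_, ?_⟩
  · intro j hj
    dsimp only
    split_ifs with h
    · exact analyticAt_const
    · refine (hpow _).mul (AnalyticAt.fun_comp (g := g j) ?_ (hpow _))
      simpa [hq.ne'] using (hng j hj h).1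
  · intro j hj
    dsimp only
    split_ifs with h
    · filter_upwards [htend.eventually h] with s hs
      simpa using hs
    · filter_upwards [htend.eventually (hng j hj h).2.2] with s hs
      rw [hs, ← mul_assoc, ← pow_add, Nat.add_sub_cancel' (hle j hj h), ← pow_mul,
        mul_comm (d - k)]
  · refine ⟨k, hk.1, ?_⟩
    dsimp only
    rw [if_neg hk.2]
    simpa [hq.ne'] using hg0
  · intro j hj h
    dsimp only
    rw [if_pos h]

/-- Partial derivative in the first variable. -/
noncomputable def dFst (f : ℝ × ℝ → ℝ) (p : ℝ × ℝ) : ℝ := fderiv ℝ f p (1, 0)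

lemma fderiv_apply_eq (f : ℝ × ℝ → ℝ) (p v : ℝ × ℝ) :
    fderiv ℝ f p v = v.1 * dFst f p + v.2 * dSnd f p := by
  have : v = v.1 • ((1, 0) : ℝ × ℝ) + v.2 • ((0, 1) : ℝ × ℝ) := by ext <;> simp
  conv_lhs => rw [this, map_add, map_smul, map_smul]
  rfl

lemma hasDerivAt_comp_pair {f : ℝ × ℝ → ℝ} {α β : ℝ → ℝ} {a b t : ℝ} (hα : HasDerivAt α a t)
    (hβ : HasDerivAt β b t) (hf : DifferentiableAt ℝ f (α t, β t)) :
    HasDerivAt (fun t => f (α t, β t))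
      (a * dFst f (α t, β t) + b * dSnd f (α t, β t)) t := by
  have := HasFDerivAt.comp_hasDerivAt (f := fun t => (α t, β t)) t hf.hasFDerivAt (hα.prodMk hβ)
  rw [fderiv_apply_eq] at this
  exact this

lemma hasDerivAt_fst {f : ℝ × ℝ → ℝ} {p : ℝ × ℝ} (hf : DifferentiableAt ℝ f p) :
    HasDerivAt (fun t => f (t, p.2)) (dFst f p) p.1 := by
  have := hasDerivAt_comp_pair (f := f) (hasDerivAt_id p.1) (hasDerivAt_const p.1 p.2) hf
  simpa using this

lemma mul_deriv_pos {c c' : ℝ → ℝ} {r : ℝ} (hr : 0 < r) (hcont : ContinuousOn c (Set.Icc 0 r))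
    (hder : ∀ x ∈ Set.Ioc 0 r, HasDerivAt c (c' x) x) (hne : ∀ x ∈ Set.Ioc 0 r, c' x ≠ 0)
    (h0 : c 0 = 0) : 0 < c r * c' r := by
  have hr' : r ∈ Set.Ioc 0 r := ⟨hr, le_rfl⟩
  have hint : ∀ x ∈ interior (Set.Icc 0 r), x ∈ Set.Ioc 0 r := by
    intro x hx
    rw [interior_Icc] at hx
    exact Set.Ioo_subset_Ioc_self hx
  rcases hasDerivWithinAt_forall_lt_or_forall_gt_of_forall_ne (convex_Ioc 0 r)
    (fun x hx => (hder x hx).hasDerivWithinAt) hne with h | h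
  · have hm := strictAntiOn_of_deriv_neg (convex_Icc 0 r) hcont fun x hx => by
      rw [(hder x (hint x hx)).deriv]; exact h x (hint x hx)
    have := hm (Set.left_mem_Icc.mpr hr.le) (Set.right_mem_Icc.mpr hr.le) hr
    rw [h0] at this
    exact mul_pos_of_neg_of_neg this (h r hr')
  · have hm := strictMonoOn_of_deriv_pos (convex_Icc 0 r) hcont fun x hx => by
      rw [(hder x (hint x hx)).deriv]; exact h x (hint x hx)
    have := hm (Set.left_mem_Icc.mpr hr.le) (Set.right_mem_Icc.mpr hr.le) hr
    rw [h0] at this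
    exact mul_pos this (h r hr')

lemma mul_dFst_pos_on_curve {h : ℝ × ℝ → ℝ} {τ : ℝ → ℝ} (hh : AnalyticAt ℝ h 0)
    (hτ : AnalyticAt ℝ τ 0) (hτ0 : τ 0 = 0) (h0 : h 0 = 0)
    (hc : ∀ᶠ r in 𝓝 (0 : ℝ), 0 < r → dSnd h (r, τ r) = 0 ∧ dFst h (r, τ r) ≠ 0) :
    ∀ᶠ r in 𝓝 (0 : ℝ), 0 < r → 0 < h (r, τ r) * dFst h (r, τ r) := by
  have htend : Tendsto (fun r => (r, τ r)) (𝓝 (0 : ℝ)) (𝓝 (0 : ℝ × ℝ)) := by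
    have h1 : Tendsto (fun r => (r, τ r)) (𝓝 (0 : ℝ)) (𝓝 ((0 : ℝ), τ 0)) :=
      (continuousAt_id (x := (0 : ℝ))).prodMk hτ.continuousAt
    rw [hτ0] at h1
    exact h1
  obtain ⟨ε, hε, hball⟩ := Metric.eventually_nhds_iff_ball.mp
    (hc.and ((htend.eventually hh.eventually_analyticAt).and hτ.eventually_analyticAt))
  filter_upwards [Metric.ball_mem_nhds _ hε] with r hr hr0
  have hmem : ∀ x ∈ Set.Icc 0 r, x ∈ Metric.ball (0 : ℝ) ε := by
    intro x hx
    rw [mem_ball_zero_iff, Real.norm_eq_abs, abs_lt] at hr ⊢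
    exact ⟨by linarith [hx.1], by linarith [hx.2]⟩
  have hder : ∀ x ∈ Set.Icc 0 r, HasDerivAt (fun x => h (x, τ x))
      (1 * dFst h (x, τ x) + deriv τ x * dSnd h (x, τ x)) x := fun x hx =>
    hasDerivAt_comp_pair (hasDerivAt_id x)
      ((hball x (hmem x hx)).2.2.differentiableAt.hasDerivAt)
      (hball x (hmem x hx)).2.1.differentiableAt
  refine mul_deriv_pos (c := fun r => h (r, τ r)) (c' := fun r => dFst h (r, τ r)) hr0
    (fun x hx => (hder x hx).continuousAt.continuousWithinAt) ?_ ?_ (by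
      rw [hτ0]
      exact h0)
  · intro x hx
    have h1 := hder x (Set.Ioc_subset_Icc_self hx)
    have h2 := (hball x (hmem x (Set.Ioc_subset_Icc_self hx))).1 hx.1
    simpa [h2.1] using h1
  · intro x hx
    exact ((hball x (hmem x (Set.Ioc_subset_Icc_self hx))).1 hx.1).2

/-- At critical points of `h` in the second variable, `h` has the sign of its derivative in the
first variable. -/
def RadialSign (h : ℝ × ℝ → ℝ) : Prop :=
  ∀ᶠ p in 𝓝 (0 : ℝ × ℝ), 0 < p.1 → dSnd h p = 0 → 0 < h p * dFst h p

/-- Analytic germs vanishing on the axis `p.1 = 0` and without critical points off it. -/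
structure RadialRegular (h : ℝ × ℝ → ℝ) : Prop where
  analyticAt : AnalyticAt ℝ h 0
  zero : ∀ᶠ p in 𝓝 (0 : ℝ × ℝ), p.1 = 0 → h p = 0
  ne_zero : ∀ᶠ p in 𝓝 (0 : ℝ × ℝ), 0 < p.1 → dSnd h p = 0 → dFst h p ≠ 0

/-- `RadialSign` for germs whose second partial derivative is a power of the first variable times
a function with a zero of order `d` along the axis. -/
def RadialSignOfOrder (d : ℕ) : Prop :=
  ∀ (h g : ℝ × ℝ → ℝ) (m : ℕ), RadialRegular h → AnalyticAt ℝ g 0 →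
    (∀ᶠ p in 𝓝 (0 : ℝ × ℝ), 0 < p.1 → dSnd h p = p.1 ^ m * g p) →
    (∀ j < d, (dSnd^[j] g) 0 = 0) → (dSnd^[d] g) 0 ≠ 0 → RadialSign h

lemma analyticAt_fst' {p : ℝ × ℝ} : AnalyticAt ℝ (fun p : ℝ × ℝ => p.1) p := analyticAt_fst
lemma analyticAt_snd' {p : ℝ × ℝ} : AnalyticAt ℝ (fun p : ℝ × ℝ => p.2) p := analyticAt_snd

section Substitution

variable {h k : ℝ × ℝ → ℝ} {q : ℕ}

lemma analyticAt_powMap (q : ℕ) (hk : AnalyticAt ℝ k 0) :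
    AnalyticAt ℝ (fun x : ℝ × ℝ => (x.1 ^ q, k x)) 0 :=
  (analyticAt_fst'.fun_pow q).prod hk

lemma tendsto_powMap (hq : 0 < q) (hk : AnalyticAt ℝ k 0) (hk0 : k 0 = 0) :
    Tendsto (fun x : ℝ × ℝ => (x.1 ^ q, k x)) (𝓝 0) (𝓝 0) := by
  have h1 : Tendsto (fun x : ℝ × ℝ => (x.1 ^ q, k x)) (𝓝 0) (𝓝 ((0 : ℝ) ^ q, k 0)) :=
    (analyticAt_powMap q hk).continuousAt
  rw [hk0, zero_pow hq.ne'] at h1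
  exact h1

lemma analyticAt_comp_powMap (hh : AnalyticAt ℝ h 0) (hq : 0 < q) (hk : AnalyticAt ℝ k 0)
    (hk0 : k 0 = 0) : AnalyticAt ℝ (fun x : ℝ × ℝ => h (x.1 ^ q, k x)) 0 := by
  refine AnalyticAt.fun_comp (g := h) ?_ (analyticAt_powMap q hk)
  have : (((0 : ℝ × ℝ).1) ^ q, k 0) = (0 : ℝ × ℝ) := by
    rw [hk0]; simp [hq.ne']
  rwa [this]

lemma partials_comp_powMap (hh : AnalyticAt ℝ h 0) (hq : 0 < q) (hk : AnalyticAt ℝ k 0)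
    (hk0 : k 0 = 0) : ∀ᶠ x in 𝓝 (0 : ℝ × ℝ),
      dSnd (fun x : ℝ × ℝ => h (x.1 ^ q, k x)) x = dSnd k x * dSnd h (x.1 ^ q, k x) ∧
      dFst (fun x : ℝ × ℝ => h (x.1 ^ q, k x)) x =
        q * x.1 ^ (q - 1) * dFst h (x.1 ^ q, k x) + dFst k x * dSnd h (x.1 ^ q, k x) := by
  filter_upwards [(analyticAt_comp_powMap hh hq hk hk0).eventually_analyticAt,
    hk.eventually_analyticAt, (tendsto_powMap hq hk hk0).eventually hh.eventually_analyticAt]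
    with x h1 h2 h3
  constructor
  · have e1 := hasDerivAt_snd h1.differentiableAt
    have e2 := hasDerivAt_comp_pair (f := h) (hasDerivAt_const x.2 (x.1 ^ q))
      (hasDerivAt_snd h2.differentiableAt) h3.differentiableAt
    simpa using e1.unique e2
  · have e1 := hasDerivAt_fst h1.differentiableAt
    have e2 := hasDerivAt_comp_pair (f := h) (hasDerivAt_pow q x.1)
      (hasDerivAt_fst h2.differentiableAt) h3.differentiableAt
    simpa using e1.unique e2

lemma RadialRegular.comp_powMap (hh : RadialRegular h) (hq : 0 < q) (hk : AnalyticAt ℝ k 0)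
    (hk0 : k 0 = 0) (hk1 : ∀ᶠ x in 𝓝 (0 : ℝ × ℝ), 0 < x.1 → dSnd k x ≠ 0) :
    RadialRegular (fun x : ℝ × ℝ => h (x.1 ^ q, k x)) := by
  refine ⟨analyticAt_comp_powMap hh.analyticAt hq hk hk0, ?_, ?_⟩
  · filter_upwards [(tendsto_powMap hq hk hk0).eventually hh.zero] with x hx h0
    exact hx (by simp [h0, hq.ne'])
  · filter_upwards [partials_comp_powMap hh.analyticAt hq hk hk0, hk1,
      (tendsto_powMap hq hk hk0).eventually hh.ne_zero] with x h1 h2 h3 hx hd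
    rw [h1.1, mul_eq_zero, or_iff_right (h2 hx)] at hd
    rw [h1.2, hd, mul_zero, add_zero]
    exact mul_ne_zero (mul_ne_zero (by exact_mod_cast hq.ne') (pow_pos hx _).ne')
      (h3 (pow_pos hx _) hd)

lemma RadialSign.of_comp_powMap (hh : AnalyticAt ℝ h 0) (hq : 0 < q) (hk : AnalyticAt ℝ k 0)
    (hk0 : k 0 = 0) (hs : RadialSign (fun x : ℝ × ℝ => h (x.1 ^ q, k x))) :
    ∀ᶠ x in 𝓝 (0 : ℝ × ℝ), 0 < x.1 → dSnd h (x.1 ^ q, k x) = 0 →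
      0 < h (x.1 ^ q, k x) * dFst h (x.1 ^ q, k x) := by
  filter_upwards [partials_comp_powMap hh hq hk hk0, hs] with x h1 h2 hx hd
  have := h2 hx (by rw [h1.1, hd, mul_zero])
  rw [h1.2, hd, mul_zero, add_zero, mul_left_comm] at this
  exact (pos_iff_pos_of_mul_pos this).mp
    (mul_pos (by exact_mod_cast hq) (pow_pos hx _))

end Substitution

lemma RadialSign.of_shift {h : ℝ × ℝ → ℝ} {τ : ℝ → ℝ} (hh : AnalyticAt ℝ h 0)
    (hτ : AnalyticAt ℝ τ 0) (hτ0 : τ 0 = 0)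
    (hs : RadialSign (fun x : ℝ × ℝ => h (x.1, τ x.1 + x.2))) : RadialSign h := by
  have hτ' : AnalyticAt ℝ (fun x : ℝ × ℝ => τ x.1) 0 := 
    AnalyticAt.fun_comp (g := τ) (f := fun x : ℝ × ℝ => x.1) (x := 0) hτ analyticAt_fst'
  have h1 := RadialSign.of_comp_powMap (q := 1) hh one_pos
    (k := fun x : ℝ × ℝ => τ x.1 + x.2) (hτ'.fun_add analyticAt_snd') (by simpa) (by simpa using hs)
  have ht : Tendsto (fun x : ℝ × ℝ => (x.1, x.2 - τ x.1)) (𝓝 0) (𝓝 0) := by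
    have h1 : Tendsto (fun x : ℝ × ℝ => (x.1, x.2 - τ x.1)) (𝓝 0) (𝓝 ((0 : ℝ), (0 : ℝ) - τ 0)) :=
      (analyticAt_fst'.prod (analyticAt_snd'.fun_sub hτ')).continuousAt (x := (0 : ℝ × ℝ))
    rw [hτ0, sub_zero] at h1
    exact h1
  filter_upwards [ht.eventually h1] with x hx
  simpa using hx

lemma dSnd_shift_ne_zero {τ : ℝ → ℝ} (hτ : AnalyticAt ℝ τ 0) :
    ∀ᶠ x in 𝓝 (0 : ℝ × ℝ), dSnd (fun x : ℝ × ℝ => τ x.1 + x.2) x = 1 := by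
  have hτ' : AnalyticAt ℝ (fun x : ℝ × ℝ => τ x.1) 0 :=
    AnalyticAt.fun_comp (g := τ) (f := fun x : ℝ × ℝ => x.1) (x := 0) hτ analyticAt_fst'
  filter_upwards [(hτ'.fun_add analyticAt_snd').eventually_analyticAt] with x hx
  have h1 := hasDerivAt_snd hx.differentiableAt
  exact h1.unique ((hasDerivAt_id x.2).const_add (τ x.1))

lemma RadialRegular.shift {h : ℝ × ℝ → ℝ} {τ : ℝ → ℝ} (hh : RadialRegular h)
    (hτ : AnalyticAt ℝ τ 0) (hτ0 : τ 0 = 0) :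
    RadialRegular (fun x : ℝ × ℝ => h (x.1, τ x.1 + x.2)) := by
  have hτ' : AnalyticAt ℝ (fun x : ℝ × ℝ => τ x.1) 0 :=
    AnalyticAt.fun_comp (g := τ) (f := fun x : ℝ × ℝ => x.1) (x := 0) hτ analyticAt_fst'
  have := hh.comp_powMap (q := 1) one_pos (k := fun x : ℝ × ℝ => τ x.1 + x.2)
    (hτ'.fun_add analyticAt_snd') (by simpa) (by
      filter_upwards [dSnd_shift_ne_zero hτ] with x hx _
      rw [hx]; exact one_ne_zero)
  simpa using this

lemma tendsto_shift {τ : ℝ → ℝ} (hτ : AnalyticAt ℝ τ 0) (hτ0 : τ 0 = 0) :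
    Tendsto (fun x : ℝ × ℝ => (x.1, τ x.1 + x.2)) (𝓝 0) (𝓝 0) := by
  have hτ' : AnalyticAt ℝ (fun x : ℝ × ℝ => τ x.1) 0 :=
    AnalyticAt.fun_comp (g := τ) (f := fun x : ℝ × ℝ => x.1) (x := 0) hτ analyticAt_fst'
  simpa using tendsto_powMap one_pos (k := fun x : ℝ × ℝ => τ x.1 + x.2)
    (hτ'.fun_add analyticAt_snd') (by simpa)

lemma analyticAt_comp_shift {g : ℝ × ℝ → ℝ} {τ : ℝ → ℝ} (hg : AnalyticAt ℝ g 0)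
    (hτ : AnalyticAt ℝ τ 0) (hτ0 : τ 0 = 0) :
    AnalyticAt ℝ (fun x : ℝ × ℝ => g (x.1, τ x.1 + x.2)) 0 := by
  have hτ' : AnalyticAt ℝ (fun x : ℝ × ℝ => τ x.1) 0 :=
    AnalyticAt.fun_comp (g := τ) (f := fun x : ℝ × ℝ => x.1) (x := 0) hτ analyticAt_fst'
  simpa using analyticAt_comp_powMap hg one_pos (k := fun x : ℝ × ℝ => τ x.1 + x.2)
    (hτ'.fun_add analyticAt_snd') (by simpa)

lemma iterate_dSnd_comp_shift {g : ℝ × ℝ → ℝ} {τ : ℝ → ℝ} (hg : AnalyticAt ℝ g 0)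
    (hτ : AnalyticAt ℝ τ 0) (hτ0 : τ 0 = 0) (j : ℕ) : ∀ᶠ x in 𝓝 (0 : ℝ × ℝ),
      (dSnd^[j] fun x : ℝ × ℝ => g (x.1, τ x.1 + x.2)) x = (dSnd^[j] g) (x.1, τ x.1 + x.2) := by
  filter_upwards [(analyticAt_comp_shift hg hτ hτ0).eventually_analyticAt,
    (tendsto_shift hτ hτ0).eventually hg.eventually_analyticAt] with x h1 h2
  rw [h1.iterate_dSnd_eq, h2.iterate_dSnd_eq]
  exact congrFun (iteratedDeriv_comp_const_add j (fun t => g (x.1, t)) (τ x.1)) x.2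

/-- Tschirnhaus expansion: after a shift the coefficient of order `d - 1` vanishes. -/
lemma AnalyticAt.exists_shift_expansion {g : ℝ × ℝ → ℝ} (hg : AnalyticAt ℝ g 0) {d : ℕ}
    (hd : 0 < d) (hz : ∀ j < d, (_root_.dSnd^[j] g) 0 = 0) (hnz : (_root_.dSnd^[d] g) 0 ≠ 0) :
    ∃ (τ : ℝ → ℝ) (a : ℕ → ℝ → ℝ) (e : ℝ × ℝ → ℝ), AnalyticAt ℝ τ 0 ∧ τ 0 = 0 ∧
      (∀ j, AnalyticAt ℝ (a j) 0) ∧ (∀ j < d, a j 0 = 0) ∧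
      (∀ᶠ r in 𝓝 (0 : ℝ), a (d - 1) r = 0) ∧ AnalyticAt ℝ e 0 ∧ e 0 ≠ 0 ∧
      ∀ᶠ p in 𝓝 (0 : ℝ × ℝ), g (p.1, τ p.1 + p.2) =
        ∑ j ∈ Finset.range d, a j p.1 * p.2 ^ j + p.2 ^ d * e p := by
  obtain ⟨τ, hτ, hτ0, hτz⟩ := (hg.iterate_dSnd (d - 1)).exists_implicit (hz _ (by omega)) (by
    rw [← Function.iterate_succ_apply' _root_.dSnd]
    rwa [Nat.succ_eq_add_one, Nat.sub_add_cancel hd])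
  have hg1 := analyticAt_comp_shift hg hτ hτ0
  obtain ⟨e, he, he0, hexp⟩ := hg1.exists_taylor_snd d
  have hit := iterate_dSnd_comp_shift hg hτ hτ0
  have hval : ∀ j, (_root_.dSnd^[j] fun x : ℝ × ℝ => g (x.1, τ x.1 + x.2)) 0
      = (_root_.dSnd^[j] g) 0 := fun j => by
    rw [(hit j).self_of_nhds]
    simp [hτ0, Prod.zero_eq_mk]
  have hr : Tendsto (fun r : ℝ => (r, (0 : ℝ))) (𝓝 0) (𝓝 0) :=
    (by fun_prop : Continuous fun r : ℝ => (r, (0 : ℝ))).tendsto' _ _ rfl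
  refine ⟨τ, fun j r => (_root_.dSnd^[j] fun x : ℝ × ℝ => g (x.1, τ x.1 + x.2)) (r, 0) / j.factorial,
    e, hτ, hτ0, ?_, ?_, ?_, he, ?_, hexp⟩
  · intro j
    refine AnalyticAt.fun_div ?_ analyticAt_const (by positivity)
    exact AnalyticAt.fun_comp (f := fun r : ℝ => (r, (0 : ℝ))) (x := 0) (hg1.iterate_dSnd j)
      (analyticAt_id.prod analyticAt_const)
  · intro j hj
    have := hval j
    rw [hz j hj] at this
    change (_root_.dSnd^[j] _) (0 : ℝ × ℝ) / _ = _
    rw [this, zero_div]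
  · filter_upwards [hr.eventually (hit (d - 1)), hτz] with r h1 h2
    rw [h1]
    simp [h2]
  · intro h
    rw [hval, h, mul_zero] at he0
    exact hnz he0

lemma radialSign_blowup {d : ℕ} (hd : 0 < d) (IH : ∀ d' < d, RadialSignOfOrder d')
    {h g e : ℝ × ℝ → ℝ} {a b : ℕ → ℝ → ℝ} {m p q : ℕ} (hh : RadialRegular h)
    (hfac : ∀ᶠ x in 𝓝 (0 : ℝ × ℝ), 0 < x.1 → dSnd h x = x.1 ^ m * g x)
    (he : AnalyticAt ℝ e 0) (he0 : e 0 ≠ 0)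
    (hexp : ∀ᶠ x in 𝓝 (0 : ℝ × ℝ), g x =
        ∑ j ∈ Finset.range d, a j x.1 * x.2 ^ j + x.2 ^ d * e x)
    (hp : 0 < p) (hq : 0 < q) (hb : ∀ j < d, AnalyticAt ℝ (b j) 0)
    (hab : ∀ j < d, ∀ᶠ s in 𝓝 (0 : ℝ), a j (s ^ q) = s ^ (p * (d - j)) * b j s)
    (hex : ∃ j < d, b j 0 ≠ 0) (hb1 : b (d - 1) 0 = 0) (u : ℝ) :
    ∀ᶠ x in 𝓝 (0 : ℝ × ℝ), 0 < x.1 → dSnd h (x.1 ^ q, x.1 ^ p * (u + x.2)) = 0 →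
      0 < h (x.1 ^ q, x.1 ^ p * (u + x.2)) * dFst h (x.1 ^ q, x.1 ^ p * (u + x.2)) := by
  classical
  let k : ℝ × ℝ → ℝ := fun x => x.1 ^ p * (u + x.2)
  have hk : ∀ x, AnalyticAt ℝ k x := fun x =>
    (analyticAt_fst'.fun_pow p).fun_mul (analyticAt_const.fun_add analyticAt_snd')
  have hk0 : k 0 = 0 := by simp [k, hp.ne']
  have hkd : ∀ x, dSnd k x = x.1 ^ p := fun x => by
    have h1 := hasDerivAt_snd (hk x).differentiableAt
    have h2 := ((hasDerivAt_id x.2).const_add u).const_mul (x.1 ^ p)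
    simpa using h1.unique h2
  have hb' : ∀ j < d, AnalyticAt ℝ (fun x : ℝ × ℝ => b j x.1) 0 := fun j hj =>
    AnalyticAt.fun_comp (g := b j) (f := fun x : ℝ × ℝ => x.1) (x := 0) (hb j hj) analyticAt_fst'
  let G : ℝ × ℝ → ℝ := fun x => ∑ j ∈ Finset.range d, b j x.1 * (u + x.2) ^ j
    + (u + x.2) ^ d * e (x.1 ^ q, k x)
  have hG : AnalyticAt ℝ G 0 := by
    refine AnalyticAt.fun_add (Finset.analyticAt_fun_sum _ fun j hj => ?_) ?_
    · exact (hb' j (Finset.mem_range.mp hj)).fun_mul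
        ((analyticAt_const.fun_add analyticAt_snd').fun_pow j)
    · exact ((analyticAt_const.fun_add analyticAt_snd').fun_pow d).fun_mul
        (analyticAt_comp_powMap he hq (hk 0) hk0)
  have hGd : ∃ j < d, (dSnd^[j] G) 0 ≠ 0 := by
    obtain ⟨j, hj, hj'⟩ := Polynomial.exists_iteratedDeriv_ne_zero hd he0 hb1 hex u
    refine ⟨j, hj, ?_⟩
    rw [hG.iterate_dSnd_eq]
    have h0 : (fun t => G ((0 : ℝ × ℝ).1, t)) = fun t => ∑ j ∈ Finset.range d,
        b j 0 * (u + t) ^ j + (u + t) ^ d * e 0 := by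
      funext t
      simp [G, k, hp.ne', hq.ne', Prod.zero_eq_mk]
    rw [h0]
    exact hj'
  obtain ⟨hj, hj'⟩ := Nat.find_spec hGd
  have hfst : Tendsto (fun x : ℝ × ℝ => x.1) (𝓝 0) (𝓝 0) := continuous_fst.tendsto' _ _ rfl
  have hab' : ∀ᶠ x in 𝓝 (0 : ℝ × ℝ), ∀ j ∈ Finset.range d,
      a j (x.1 ^ q) = x.1 ^ (p * (d - j)) * b j x.1 :=
    (eventually_all_finset _).mpr fun j hj => hfst.eventually (hab j (Finset.mem_range.mp hj))
  refine RadialSign.of_comp_powMap hh.analyticAt hq (hk 0) hk0 ?_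
  refine IH (Nat.find hGd) hj _ G (p + q * m + p * d)
    (hh.comp_powMap hq (hk 0) hk0 (Eventually.of_forall fun x hx => ?_)) hG ?_ ?_ hj'
  · rw [hkd]; exact (pow_pos hx _).ne'
  · filter_upwards [partials_comp_powMap hh.analyticAt hq (hk 0) hk0, hab',
      (tendsto_powMap hq (hk 0) hk0).eventually hfac,
      (tendsto_powMap hq (hk 0) hk0).eventually hexp] with x h1 h2 h3 h4 hx
    rw [h1.1, h3 (pow_pos hx _), hkd, h4]
    have h5 : ∑ j ∈ Finset.range d, a j (x.1 ^ q) * k x ^ j =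
        x.1 ^ (p * d) * ∑ j ∈ Finset.range d, b j x.1 * (u + x.2) ^ j := by
      rw [Finset.mul_sum]
      refine Finset.sum_congr rfl fun j hj => ?_
      have hjd : p * d = p * (d - j) + p * j := by
        rw [← mul_add, Nat.sub_add_cancel (Finset.mem_range.mp hj).le]
      rw [h2 j hj, hjd, show k x = x.1 ^ p * (u + x.2) from rfl, mul_pow, pow_add, ← pow_mul]
      ring
    rw [h5, show G x = ∑ j ∈ Finset.range d, b j x.1 * (u + x.2) ^ j
      + (u + x.2) ^ d * e (x.1 ^ q, k x) from rfl]
    have h6 : k x ^ d = x.1 ^ (p * d) * (u + x.2) ^ d := by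
      rw [show k x = x.1 ^ p * (u + x.2) from rfl, mul_pow, ← pow_mul]
    rw [h6]
    ring
  · intro i hi
    by_contra hne
    exact Nat.find_min hGd hi ⟨hi.trans hj, hne⟩

lemma radialSign_centered {d : ℕ} (hd : 0 < d) (IH : ∀ d' < d, RadialSignOfOrder d')
    {h g e : ℝ × ℝ → ℝ} {a : ℕ → ℝ → ℝ} {m : ℕ} (hh : RadialRegular h)
    (hfac : ∀ᶠ x in 𝓝 (0 : ℝ × ℝ), 0 < x.1 → dSnd h x = x.1 ^ m * g x)
    (ha : ∀ j, AnalyticAt ℝ (a j) 0) (ha0 : ∀ j < d, a j 0 = 0)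
    (ha1 : ∀ᶠ r in 𝓝 (0 : ℝ), a (d - 1) r = 0) (he : AnalyticAt ℝ e 0) (he0 : e 0 ≠ 0)
    (hexp : ∀ᶠ x in 𝓝 (0 : ℝ × ℝ), g x =
        ∑ j ∈ Finset.range d, a j x.1 * x.2 ^ j + x.2 ^ d * e x) :
    RadialSign h := by
  have hfst : Tendsto (fun x : ℝ × ℝ => x.1) (𝓝 0) (𝓝 0) := continuous_fst.tendsto' _ _ rfl
  have hene : ∀ᶠ x in 𝓝 (0 : ℝ × ℝ), |e 0| / 2 < |e x| :=
    he.continuousAt.abs.eventually_const_lt (by linarith [abs_pos.mpr he0])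
  have hr : Tendsto (fun r : ℝ => (r, (0 : ℝ))) (𝓝 0) (𝓝 0) :=
    (by fun_prop : Continuous fun r : ℝ => (r, (0 : ℝ))).tendsto' _ _ rfl
  by_cases hall : ∀ j < d, ∀ᶠ r in 𝓝 (0 : ℝ), a j r = 0
  · have hg : ∀ᶠ x in 𝓝 (0 : ℝ × ℝ), 0 < x.1 → dSnd h x = x.1 ^ m * (x.2 ^ d * e x) := by
      have : ∀ᶠ x in 𝓝 (0 : ℝ × ℝ), ∀ j ∈ Finset.range d, a j x.1 = 0 :=
        (eventually_all_finset _).mpr fun j hj =>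
          hfst.eventually (hall j (Finset.mem_range.mp hj))
      filter_upwards [this, hfac, hexp] with x h1 h2 h3 hx
      rw [h2 hx, h3, Finset.sum_eq_zero fun j hj => by rw [h1 j hj, zero_mul], zero_add]
    have hcurve := mul_dFst_pos_on_curve (τ := fun _ => 0) hh.analyticAt analyticAt_const rfl
      (hh.zero.self_of_nhds rfl) (by
        filter_upwards [hr.eventually hg, hr.eventually hh.ne_zero] with r h1 h2 hr0
        have : dSnd h (r, 0) = 0 := by rw [h1 hr0]; simp [hd.ne']
        exact ⟨this, h2 hr0 this⟩)
    filter_upwards [hg, hene, hfst.eventually hcurve] with x h1 h2 h3 hx hdx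
    rw [h1 hx] at hdx
    have hex : e x ≠ 0 := abs_pos.mp (lt_trans (by positivity) h2)
    have hx2 : x.2 = 0 := by simpa [hx.ne', hex, hd.ne'] using hdx
    have : x = (x.1, 0) := by ext <;> simp [hx2]
    rw [this]
    exact h3 hx
  have hall : ∃ j < d, ¬ ∀ᶠ r in 𝓝 (0 : ℝ), a j r = 0 := by
    by_contra! hcon
    exact hall fun j hj => by simpa using hcon j hj
  obtain ⟨p, q, hp, hq, b, hb, hab, hbex, hbz⟩ := exists_newton_slope (fun j _ => ha j) ha0 hall
  have hloc := radialSign_blowup hd IH hh hfac he he0 hexp hp hq hb hab hbex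
    (hbz (d - 1) (by omega) ha1)
  obtain ⟨C, hC0, hC⟩ : ∃ C : ℝ, 0 < C ∧ ∀ᶠ s in 𝓝 (0 : ℝ), ∀ j ∈ Finset.range d, |b j s| ≤ C := by
    refine ⟨∑ j ∈ Finset.range d, |b j 0| + 1, by positivity, (eventually_all_finset _).mpr
      fun j hj => ?_⟩
    have h1 : ∀ᶠ s in 𝓝 (0 : ℝ), |b j s| < |b j 0| + 1 :=
      (hb j (Finset.mem_range.mp hj)).continuousAt.abs.eventually_lt_const (by linarith)
    filter_upwards [h1] with s hs
    have := Finset.single_le_sum (f := fun j => |b j 0|) (fun j _ => abs_nonneg _) hj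
    linarith
  set M : ℝ := 2 * (d * C) / |e 0| + 1 with hM
  have hM1 : 1 ≤ M := by rw [hM]; linarith [show 0 ≤ 2 * (d * C) / |e 0| by positivity]
  have hsmall : ∀ᶠ s in 𝓝 (0 : ℝ), ∀ u ∈ Set.Icc (-M) M, 0 < s → dSnd h (s ^ q, s ^ p * u) = 0 →
      0 < h (s ^ q, s ^ p * u) * dFst h (s ^ q, s ^ p * u) := by
    refine isCompact_Icc.eventually_forall_of_forall_eventually fun u _ => ?_
    have ht : Tendsto (fun x : ℝ × ℝ => (x.1, x.2 - u)) (𝓝 (0, u)) (𝓝 0) :=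
      (by fun_prop : Continuous fun x : ℝ × ℝ => (x.1, x.2 - u)).tendsto' _ _ (by
        simp [Prod.zero_eq_mk])
    filter_upwards [ht.eventually (hloc u)] with x hx
    simpa using hx
  have hroot : Tendsto (fun x : ℝ × ℝ => x.1 ^ ((q : ℝ)⁻¹)) (𝓝 0) (𝓝 0) := by
    have : Tendsto (fun r : ℝ => r ^ ((q : ℝ)⁻¹)) (𝓝 0) (𝓝 0) :=
      (Real.continuous_rpow_const (by positivity)).tendsto' _ _
        (Real.zero_rpow (by positivity))
    exact this.comp hfst
  have hab' : ∀ᶠ s in 𝓝 (0 : ℝ), ∀ j ∈ Finset.range d,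
      a j (s ^ q) = s ^ (p * (d - j)) * b j s :=
    (eventually_all_finset _).mpr fun j hj => hab j (Finset.mem_range.mp hj)
  filter_upwards [hroot.eventually hsmall, hroot.eventually hab', hroot.eventually hC, hexp, hfac,
    hene] with x h1 h2 h3 h4 h5 h6 hx hdx
  set s := x.1 ^ ((q : ℝ)⁻¹) with hs
  have hs0 : 0 < s := Real.rpow_pos_of_pos hx _
  have hsq : s ^ q = x.1 := Real.rpow_inv_natCast_pow hx.le hq.ne'
  set u := x.2 / s ^ p with hu
  have hsu : s ^ p * u = x.2 := mul_div_cancel₀ _ (pow_pos hs0 _).ne'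
  have hx' : x = (s ^ q, s ^ p * u) := by rw [hsq, hsu]
  by_cases huM : |u| ≤ M
  · rw [hx']
    exact h1 u (abs_le.mp huM) hs0 (by rwa [← hx'])
  exfalso
  push Not at huM
  rw [h5 hx, mul_eq_zero, or_iff_right (pow_pos hx _).ne', h4] at hdx
  have hsum : ∑ j ∈ Finset.range d, a j x.1 * x.2 ^ j =
      s ^ (p * d) * ∑ j ∈ Finset.range d, b j s * u ^ j := by
    rw [Finset.mul_sum]
    refine Finset.sum_congr rfl fun j hj => ?_
    have hjd : p * d = p * (d - j) + p * j := by
      rw [← mul_add, Nat.sub_add_cancel (Finset.mem_range.mp hj).le]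
    rw [← hsq, h2 j hj, hjd, ← hsu]
    ring
  rw [hsum, ← hsu, mul_pow, ← pow_mul, mul_assoc, ← mul_add, mul_eq_zero,
    or_iff_right (pow_pos hs0 _).ne'] at hdx
  have hu1 : 1 ≤ |u| := hM1.trans huM.le
  have hbound : |∑ j ∈ Finset.range d, b j s * u ^ j| ≤ d * C * |u| ^ (d - 1) := by
    refine (Finset.abs_sum_le_sum_abs _ _).trans ?_
    have : ∀ j ∈ Finset.range d, |b j s * u ^ j| ≤ C * |u| ^ (d - 1) := by
      intro j hj
      rw [abs_mul, abs_pow]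
      exact mul_le_mul (h3 j hj)
        (pow_le_pow_right₀ hu1 (by have := Finset.mem_range.mp hj; omega)) (by positivity) hC0.le
    refine (Finset.sum_le_card_nsmul _ _ _ this).trans ?_
    rw [Finset.card_range, nsmul_eq_mul, mul_assoc]
  have h7 : |u| ^ d * |e x| ≤ d * C * |u| ^ (d - 1) := by
    rw [← abs_pow, ← abs_mul, eq_neg_of_add_eq_zero_right hdx, abs_neg]
    exact hbound
  have h8 : |u| ^ d = |u| ^ (d - 1) * |u| := by rw [← pow_succ, Nat.sub_add_cancel hd]
  rw [h8, mul_assoc, mul_comm (d * C : ℝ)] at h7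
  have h9 := le_of_mul_le_mul_left h7 (by positivity)
  have h10 : M * (|e 0| / 2) < |u| * |e x| :=
    mul_lt_mul'' huM h6 (by linarith) (by positivity)
  have h11 : d * C ≤ M * (|e 0| / 2) := by
    rw [hM]
    have := abs_pos.mpr he0
    field_simp
    nlinarith
  linarith

theorem radialSignOfOrder (d : ℕ) : RadialSignOfOrder d := by
  induction d using Nat.strong_induction_on with
  | _ d IH =>
  intro h g m hh hg hfac hz hnz
  rcases Nat.eq_zero_or_pos d with rfl | hd
  · filter_upwards [hfac, hg.continuousAt.eventually_ne hnz] with x h1 h2 hx hdx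
    rw [h1 hx] at hdx
    exact absurd hdx (mul_ne_zero (pow_pos hx _).ne' h2)
  obtain ⟨τ, a, e, hτ, hτ0, ha, ha0, ha1, he, he0, hexp⟩ := hg.exists_shift_expansion hd hz hnz
  refine RadialSign.of_shift hh.analyticAt hτ hτ0 ?_
  refine radialSign_centered hd IH (g := fun x => g (x.1, τ x.1 + x.2)) (m := m)
    (hh.shift hτ hτ0) ?_ ha ha0 ha1 he he0 hexp
  have hτ' : AnalyticAt ℝ (fun x : ℝ × ℝ => τ x.1) 0 :=
    AnalyticAt.fun_comp (g := τ) (f := fun x : ℝ × ℝ => x.1) (x := 0) hτ analyticAt_fst'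
  have hp := partials_comp_powMap hh.analyticAt one_pos (k := fun x : ℝ × ℝ => τ x.1 + x.2)
    (hτ'.fun_add analyticAt_snd') (by simpa)
  filter_upwards [hp, dSnd_shift_ne_zero hτ, (tendsto_shift hτ hτ0).eventually hfac]
    with x h1 h2 h3 hx
  have h4 := h1.1
  simp only [pow_one] at h4
  rw [h4, h2, one_mul]
  exact h3 hx

lemma AnalyticAt.exists_eq_add_fst_mul {f : ℝ × ℝ → ℝ} (hf : AnalyticAt ℝ f 0) :
    ∃ G : ℝ × ℝ → ℝ, AnalyticAt ℝ G 0 ∧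
      ∀ᶠ p in 𝓝 (0 : ℝ × ℝ), f p = f (0, p.2) + p.1 * G p := by
  have hsw : AnalyticAt ℝ (fun p : ℝ × ℝ => (p.2, p.1)) 0 := analyticAt_snd'.prod analyticAt_fst'
  have ht : Tendsto (fun p : ℝ × ℝ => (p.2, p.1)) (𝓝 0) (𝓝 0) :=
    (by fun_prop : Continuous fun p : ℝ × ℝ => (p.2, p.1)).tendsto' _ _ rfl
  have hfs : AnalyticAt ℝ (fun p : ℝ × ℝ => f (p.2, p.1)) 0 :=
    AnalyticAt.fun_comp (g := f) (f := fun p : ℝ × ℝ => (p.2, p.1)) (x := 0) hf hsw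
  obtain ⟨G, hG, h⟩ := hfs.exists_eq_add_snd_mul
  refine ⟨fun p => G (p.2, p.1),
    AnalyticAt.fun_comp (g := G) (f := fun p : ℝ × ℝ => (p.2, p.1)) (x := 0) hG hsw, ?_⟩
  filter_upwards [ht.eventually h] with p hp using hp

/-- Division of an analytic germ by the largest possible power of the first variable. -/
lemma AnalyticAt.exists_eq_fst_pow_mul {f : ℝ × ℝ → ℝ} (hf : AnalyticAt ℝ f 0)
    (hne : ¬ ∀ᶠ p in 𝓝 (0 : ℝ × ℝ), f p = 0) :
    ∃ (m : ℕ) (g : ℝ × ℝ → ℝ), AnalyticAt ℝ g 0 ∧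
      (∀ᶠ p in 𝓝 (0 : ℝ × ℝ), f p = p.1 ^ m * g p) ∧ ¬ ∀ᶠ t in 𝓝 (0 : ℝ), g (0, t) = 0 := by
  by_contra! hcon
  have hall : ∀ m : ℕ, ∃ g : ℝ × ℝ → ℝ, AnalyticAt ℝ g 0 ∧
      ∀ᶠ p in 𝓝 (0 : ℝ × ℝ), f p = p.1 ^ m * g p := by
    intro m
    induction m with
    | zero => exact ⟨f, hf, by simp⟩
    | succ m ih =>
      obtain ⟨g, hg, hfg⟩ := ih
      obtain ⟨G, hG, hgG⟩ := hg.exists_eq_add_fst_mul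
      have hs : Tendsto (fun p : ℝ × ℝ => p.2) (𝓝 0) (𝓝 0) := continuous_snd.tendsto' _ _ rfl
      refine ⟨G, hG, ?_⟩
      filter_upwards [hfg, hgG, hs.eventually (hcon m g hg hfg)] with p h1 h2 h3
      rw [h1, h2, h3, zero_add, pow_succ, mul_assoc]
  refine hne ?_
  obtain ⟨ε, hε, hball⟩ := Metric.eventually_nhds_iff_ball.mp hf.eventually_analyticAt
  filter_upwards [Metric.ball_mem_nhds _ hε] with x hx
  have hlin : ∀ t : ℝ, AnalyticAt ℝ (fun t : ℝ => t • x) t := fun t =>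
    analyticAt_id.smul analyticAt_const
  have hφ : AnalyticOnNhd ℝ (fun t : ℝ => f (t • x)) (Set.Icc 0 1) := by
    intro t ht
    refine AnalyticAt.fun_comp (g := f) (f := fun t : ℝ => t • x) (x := t) (hball _ ?_) (hlin t)
    rw [mem_ball_zero_iff] at hx ⊢
    rw [norm_smul, Real.norm_eq_abs, abs_of_nonneg ht.1]
    exact (mul_le_of_le_one_left (norm_nonneg _) ht.2).trans_lt hx
  have ht0 : Tendsto (fun t : ℝ => t • x) (𝓝 0) (𝓝 0) :=
    (by fun_prop : Continuous fun t : ℝ => t • x).tendsto' _ _ (zero_smul _ _)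
  have hev : ∀ᶠ t in 𝓝 (0 : ℝ), f (t • x) = 0 := by
    rw [← analyticOrderAt_eq_top, ENat.eq_top_iff_forall_ge]
    intro m
    rw [natCast_le_analyticOrderAt (hφ 0 (by simp))]
    obtain ⟨g, hg, hfg⟩ := hall m
    refine ⟨fun t => x.1 ^ m * g (t • x), analyticAt_const.fun_mul
      (AnalyticAt.fun_comp (g := g) (f := fun t : ℝ => t • x) (x := 0) ?_ (hlin 0)), ?_⟩
    · rwa [zero_smul]
    · filter_upwards [ht0.eventually hfg] with t ht
      rw [ht]
      simp [mul_pow, mul_assoc]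
  have := hφ.eqOn_zero_of_preconnected_of_eventuallyEq_zero isPreconnected_Icc
    (by simp : (0 : ℝ) ∈ Set.Icc (0 : ℝ) 1) hev (by simp : (1 : ℝ) ∈ Set.Icc (0 : ℝ) 1)
  simpa using this

theorem RadialRegular.radialSign {h : ℝ × ℝ → ℝ} (hh : RadialRegular h) : RadialSign h := by
  by_cases hz : ∀ᶠ p in 𝓝 (0 : ℝ × ℝ), dSnd h p = 0
  · obtain ⟨ε, hε, hball⟩ := Metric.eventually_nhds_iff_ball.mp
      (hz.and (hh.zero.and (hh.ne_zero.and hh.analyticAt.eventually_analyticAt)))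
    filter_upwards [Metric.ball_mem_nhds _ hε] with x hx hx0 _
    have hmem : ∀ t ∈ Set.Icc 0 x.1, (t, x.2) ∈ Metric.ball (0 : ℝ × ℝ) ε := by
      intro t ht
      rw [mem_ball_zero_iff, Prod.norm_def, max_lt_iff] at hx ⊢
      refine ⟨?_, hx.2⟩
      have h1 := hx.1
      rw [Real.norm_eq_abs, abs_lt] at h1 ⊢
      exact ⟨by linarith [ht.1], by linarith [ht.2]⟩
    have hder : ∀ t ∈ Set.Icc 0 x.1, HasDerivAt (fun t => h (t, x.2)) (dFst h (t, x.2)) t :=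
      fun t ht => hasDerivAt_fst (p := (t, x.2)) (hball _ (hmem t ht)).2.2.2.differentiableAt
    exact mul_deriv_pos (c := fun t => h (t, x.2)) (c' := fun t => dFst h (t, x.2)) hx0
      (fun t ht => (hder t ht).continuousAt.continuousWithinAt)
      (fun t ht => hder t (Set.Ioc_subset_Icc_self ht))
      (fun t ht => (hball _ (hmem t (Set.Ioc_subset_Icc_self ht))).2.2.1 ht.1
        (hball _ (hmem t (Set.Ioc_subset_Icc_self ht))).1)
      ((hball _ (hmem 0 ⟨le_rfl, hx0.le⟩)).2.1 rfl)
  obtain ⟨m, g, hg, hfg, hgz⟩ := hh.analyticAt.dSnd.exists_eq_fst_pow_mul hz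
  have hg0 : AnalyticAt ℝ (fun t : ℝ => g (0, t)) 0 :=
    AnalyticAt.fun_comp (g := g) (f := fun t : ℝ => ((0 : ℝ), t)) (x := 0) hg
      (analyticAt_const.prod analyticAt_id)
  obtain ⟨d, hd⟩ := ENat.ne_top_iff_exists.mp (fun h => hgz (analyticOrderAt_eq_top.mp h))
  have hd' := (analyticOrderAt_eq_nat_iff_iteratedDeriv_eq_zero hg0).mp hd.symm
  refine radialSignOfOrder d h g m hh hg (hfg.mono fun p hp _ => hp) (fun j hj => ?_) ?_
  · rw [hg.iterate_dSnd_eq]; exact hd'.1 j hj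
  · rw [hg.iterate_dSnd_eq]; exact hd'.2

lemma exists_polar (p : ℝ × ℝ) : ∃ θ ∈ Set.Icc (-Real.pi) Real.pi,
    p = (√(p.1 ^ 2 + p.2 ^ 2) * Real.cos θ, √(p.1 ^ 2 + p.2 ^ 2) * Real.sin θ) := by
  refine ⟨Complex.arg ⟨p.1, p.2⟩, ⟨(Complex.neg_pi_lt_arg _).le, Complex.arg_le_pi _⟩, ?_⟩
  have hn : √(p.1 ^ 2 + p.2 ^ 2) = ‖(⟨p.1, p.2⟩ : ℂ)‖ := by
    rw [Complex.norm_def, Complex.normSq_apply, sq, sq]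
  rw [hn, Complex.norm_mul_cos_arg, Complex.norm_mul_sin_arg]

/-- Near an isolated critical point at level zero, the radial derivative of `H` at points where the
angular derivative vanishes has the sign of `H`. -/
theorem exists_radius_mul_fderiv_pos {H : ℝ × ℝ → ℝ} (hH : AnalyticAt ℝ H 0) (h0 : H 0 = 0)
    (hiso : ∀ᶠ p in 𝓝 (0 : ℝ × ℝ), fderiv ℝ H p = 0 → p = 0) :
    ∃ ρ₀ > (0 : ℝ), ∀ p : ℝ × ℝ, p.1 ^ 2 + p.2 ^ 2 < ρ₀ ^ 2 → AnalyticAt ℝ H p ∧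
      (p ≠ 0 → fderiv ℝ H p (-p.2, p.1) = 0 → 0 < H p * fderiv ℝ H p p) := by
  let P : ℝ × ℝ → ℝ × ℝ := fun x => (x.1 * Real.cos x.2, x.1 * Real.sin x.2)
  have hPa : ∀ x, AnalyticAt ℝ P x := fun x => by
    have hc : AnalyticAt ℝ (fun x : ℝ × ℝ => Real.cos x.2) x :=
      AnalyticAt.fun_comp (g := Real.cos) (f := fun x : ℝ × ℝ => x.2) Real.analyticAt_cos analyticAt_snd'
    have hs : AnalyticAt ℝ (fun x : ℝ × ℝ => Real.sin x.2) x :=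
      AnalyticAt.fun_comp (g := Real.sin) (f := fun x : ℝ × ℝ => x.2) Real.analyticAt_sin analyticAt_snd'
    exact (analyticAt_fst'.fun_mul hc).prod (analyticAt_fst'.fun_mul hs)
  have hP0 : ∀ θ, P (0, θ) = 0 := fun θ => by simp [P]
  have hpart : ∀ x, AnalyticAt ℝ H (P x) →
      dFst (fun x => H (P x)) x = fderiv ℝ H (P x) (Real.cos x.2, Real.sin x.2) ∧
      dSnd (fun x => H (P x)) x = fderiv ℝ H (P x) (-(P x).2, (P x).1) := by
    intro x hx
    have hHP : AnalyticAt ℝ (fun x => H (P x)) x := AnalyticAt.fun_comp (g := H) (f := P) hx (hPa x)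
    constructor
    · refine (hasDerivAt_fst hHP.differentiableAt).unique ?_
      have h1 := hasDerivAt_comp_pair (f := H) ((hasDerivAt_id x.1).mul_const (Real.cos x.2))
        ((hasDerivAt_id x.1).mul_const (Real.sin x.2)) hx.differentiableAt
      rw [fderiv_apply_eq]
      simpa using h1
    · refine (hasDerivAt_snd hHP.differentiableAt).unique ?_
      have h1 := hasDerivAt_comp_pair (f := H) ((Real.hasDerivAt_cos x.2).const_mul x.1)
        ((Real.hasDerivAt_sin x.2).const_mul x.1) hx.differentiableAt
      rw [fderiv_apply_eq]
      simpa [P] using h1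
  have hloc : ∀ θ, ∀ᶠ x in 𝓝 ((0 : ℝ), θ), 0 < x.1 → dSnd (fun x => H (P x)) x = 0 →
      0 < H (P x) * dFst (fun x => H (P x)) x := by
    intro θ
    let k : ℝ × ℝ → ℝ × ℝ := fun x => (x.1, θ + x.2)
    have hk : ∀ x, AnalyticAt ℝ k x := fun x => analyticAt_fst'.prod
      (analyticAt_const.fun_add analyticAt_snd')
    have hka : AnalyticAt ℝ (fun x => P (k x)) 0 := AnalyticAt.fun_comp (g := P) (f := k) (hPa _) (hk 0)
    have hk0 : P (k 0) = 0 := by simp [k, hP0]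
    have hHk : AnalyticAt ℝ (fun x => H (P (k x))) 0 :=
      AnalyticAt.fun_comp (g := H) (f := fun x => P (k x)) (x := 0) (by rw [hk0]; exact hH) hka
    have ht : Tendsto (fun x => P (k x)) (𝓝 0) (𝓝 0) := by
      have := hka.continuousAt
      rwa [ContinuousAt, hk0] at this
    have hsh : ∀ᶠ x in 𝓝 (0 : ℝ × ℝ),
        dFst (fun x => H (P (k x))) x = dFst (fun x => H (P x)) (k x) ∧
        dSnd (fun x => H (P (k x))) x = dSnd (fun x => H (P x)) (k x) := by
      filter_upwards [hHk.eventually_analyticAt, ht.eventually hH.eventually_analyticAt]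
        with x h1 h2
      have h3 : AnalyticAt ℝ (fun x => H (P x)) (k x) := AnalyticAt.fun_comp (g := H) (f := P) h2 (hPa _)
      constructor
      · exact (hasDerivAt_fst h1.differentiableAt).unique (hasDerivAt_fst h3.differentiableAt)
      · refine (hasDerivAt_snd h1.differentiableAt).unique ?_
        have := (hasDerivAt_snd h3.differentiableAt).comp_const_add θ x.2
        exact this
    have hreg : RadialRegular (fun x => H (P (k x))) := by
      refine ⟨hHk, Eventually.of_forall fun x hx => ?_, ?_⟩
      · have : k x = (0, θ + x.2) := by simp [k, hx]
        rw [this, hP0, h0]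
      · filter_upwards [hsh, ht.eventually hH.eventually_analyticAt, ht.eventually hiso]
          with x h1 h2 h3 hx hdx hdx'
        rw [h1.1, (hpart _ h2).1, fderiv_apply_eq] at hdx'
        rw [h1.2, (hpart _ h2).2, fderiv_apply_eq] at hdx
        have e1 : (P (k x)).1 = x.1 * Real.cos (θ + x.2) := rfl
        have e2 : (P (k x)).2 = x.1 * Real.sin (θ + x.2) := rfl
        have e3 : (k x).2 = θ + x.2 := rfl
        simp only [e1, e2, e3] at hdx hdx'
        have hcs := Real.sin_sq_add_cos_sq (θ + x.2)
        have hdx2 : -Real.sin (θ + x.2) * dFst H (P (k x))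
            + Real.cos (θ + x.2) * dSnd H (P (k x)) = 0 := by
          have : x.1 * (-Real.sin (θ + x.2) * dFst H (P (k x))
            + Real.cos (θ + x.2) * dSnd H (P (k x))) = 0 := by linarith
          exact (mul_eq_zero.mp this).resolve_left hx.ne'
        set c := Real.cos (θ + x.2)
        set s := Real.sin (θ + x.2)
        have f1 : dFst H (P (k x)) = 0 := by linear_combination c * hdx' - s * hdx2 - hcs * dFst H (P (k x))
        have f2 : dSnd H (P (k x)) = 0 := by linear_combination s * hdx' + c * hdx2 - hcs * dSnd H (P (k x))
        have hzero := h3 (by ext <;> simp [fderiv_apply_eq, f1, f2])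
        have g1 : x.1 * c = 0 := by rw [← e1, hzero]; rfl
        have g2 : x.1 * s = 0 := by rw [← e2, hzero]; rfl
        have g1' := (mul_eq_zero.mp g1).resolve_left hx.ne'
        have g2' := (mul_eq_zero.mp g2).resolve_left hx.ne'
        rw [g1', g2'] at hcs
        norm_num at hcs
    have hmain := hreg.radialSign
    have hback : Tendsto (fun x : ℝ × ℝ => (x.1, x.2 - θ)) (𝓝 (0, θ)) (𝓝 0) :=
      (by fun_prop : Continuous fun x : ℝ × ℝ => (x.1, x.2 - θ)).tendsto' _ _ (by
        simp [Prod.zero_eq_mk])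
    filter_upwards [hback.eventually hmain, hback.eventually hsh] with x h1 h2 hx hdx
    have hkx : k (x.1, x.2 - θ) = x := by simp [k]
    rw [hkx] at h2
    rw [h2.1, h2.2] at h1
    simp only [hkx] at h1
    exact h1 hx hdx
  have hr : ∀ᶠ r in 𝓝 (0 : ℝ), ∀ θ ∈ Set.Icc (-Real.pi) Real.pi, 0 < (r, θ).1 →
      dSnd (fun x => H (P x)) (r, θ) = 0 →
      0 < H (P (r, θ)) * dFst (fun x => H (P x)) (r, θ) :=
    isCompact_Icc.eventually_forall_of_forall_eventually fun θ _ => hloc θ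
  obtain ⟨ε, hε, hball⟩ := Metric.eventually_nhds_iff_ball.mp hr
  obtain ⟨δ, hδ, hball'⟩ := Metric.eventually_nhds_iff_ball.mp hH.eventually_analyticAt
  refine ⟨min ε δ, lt_min hε hδ, fun p hp => ?_⟩
  have hpr : √(p.1 ^ 2 + p.2 ^ 2) < min ε δ := (Real.sqrt_lt' (lt_min hε hδ)).mpr hp
  have hpa : AnalyticAt ℝ H p := by
    refine hball' p ?_
    rw [mem_ball_zero_iff, Prod.norm_def, max_lt_iff, Real.norm_eq_abs, Real.norm_eq_abs]
    have hlt := hpr.trans_le (min_le_right _ _)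
    refine ⟨lt_of_le_of_lt (Real.abs_le_sqrt ?_) hlt, lt_of_le_of_lt (Real.abs_le_sqrt ?_) hlt⟩ <;>
    nlinarith [sq_nonneg p.1, sq_nonneg p.2]
  refine ⟨hpa, fun hp0 hd => ?_⟩
  obtain ⟨θ, hθ, hpθ⟩ := exists_polar p
  set r := √(p.1 ^ 2 + p.2 ^ 2) with hrdef
  have hr0 : 0 < r := by
    refine lt_of_le_of_ne (Real.sqrt_nonneg _) fun h => hp0 ?_
    rw [← h] at hpθ
    rw [hpθ]; simp
  have hPp : P (r, θ) = p := hpθ.symm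
  have hpa' : AnalyticAt ℝ H (P (r, θ)) := by rwa [hPp]
  have h1 := hball r (by
    rw [mem_ball_zero_iff, Real.norm_eq_abs, abs_of_pos hr0]
    exact hpr.trans_le (min_le_left _ _)) θ hθ hr0 (by rw [(hpart _ hpa').2, hPp, hd])
  rw [(hpart _ hpa').1, hPp] at h1
  have h2 : p = r • ((Real.cos θ, Real.sin θ) : ℝ × ℝ) := hpθ
  have h3 : fderiv ℝ H p p = r * fderiv ℝ H p (Real.cos θ, Real.sin θ) := by
    calc fderiv ℝ H p p = fderiv ℝ H p (r • ((Real.cos θ, Real.sin θ) : ℝ × ℝ)) :=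
          congrArg (fderiv ℝ H p) h2
      _ = _ := map_smul _ _ _
  rw [h3, mul_left_comm]
  exact mul_pos hr0 h1

lemma IsPreconnected.of_descent {X : Type*} [TopologicalSpace X] {Q T : Set X} {ν : X → ℝ}
    (hQ : IsCompact Q) (hν : Continuous ν) (hT : IsPreconnected T) (hTQ : T ⊆ Q)
    (hdesc : ∀ p ∈ Q, p ∉ T → ∃ᶠ q in 𝓝 p, q ∈ Q ∧ ν q < ν p) : IsPreconnected Q := by
  rw [isPreconnected_closed_iff] at hT ⊢
  intro t t' ht ht' hcov hne hne'
  by_contra hemp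
  rw [Set.not_nonempty_iff_eq_empty] at hemp
  have key : ∀ s s' : Set X, IsClosed s → IsClosed s' → Q ⊆ s ∪ s' → (Q ∩ s).Nonempty →
      Q ∩ (s ∩ s') = ∅ → (T ∩ s).Nonempty := by
    intro s s' hs hs' hcov hne hemp
    obtain ⟨p, hp, hmin⟩ := (hQ.inter_right hs).exists_isMinOn hne hν.continuousOn
    by_contra hcon
    have hpT : p ∉ T := fun h => hcon ⟨p, h, hp.2⟩
    have hps' : p ∉ s' := fun h => (Set.eq_empty_iff_forall_notMem.mp hemp p) ⟨hp.1, hp.2, h⟩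
    obtain ⟨q, ⟨hq, hlt⟩, hqs'⟩ :=
      ((hdesc p hp.1 hpT).and_eventually (hs'.isOpen_compl.mem_nhds hps')).exists
    have hqs : q ∈ s := (hcov hq).resolve_right hqs'
    exact absurd (hmin ⟨hq, hqs⟩) (not_le.mpr hlt)
  obtain ⟨x, hx, hx'⟩ := hT t t' ht ht' (hTQ.trans hcov) (key t t' ht ht' hcov hne hemp)
    (key t' t ht' ht (by rwa [Set.union_comm]) hne' (by rwa [Set.inter_comm t']))
  exact (Set.eq_empty_iff_forall_notMem.mp hemp x) ⟨hTQ hx, hx'⟩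

lemma exists_circle_lift {c : ℝ × ℝ → Circle} (hc : Continuous c) :
    ∃ F : ℝ × ℝ → ℝ, Continuous F ∧ ∀ x, Circle.exp (F x) = c x := by
  obtain ⟨t, ht⟩ : ∃ t, Circle.exp t = c 0 := ⟨_, Circle.exp_arg _⟩
  obtain ⟨F, ⟨-, hF⟩, -⟩ := Circle.isCoveringMap_exp.existsUnique_continuousMap_lifts
    (⟨c, hc⟩ : C(ℝ × ℝ, Circle)) 0 t ht
  exact ⟨F, F.continuous, fun x => congrFun hF x⟩

lemma IsPreconnected.eq_of_circle_exp_eq_one {X : Type*} [TopologicalSpace X] {A : Set X}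
    (hA : IsPreconnected A) {g : X → ℝ} (hg : ContinuousOn g A)
    (h1 : ∀ x ∈ A, Circle.exp (g x) = 1) {x y : X} (hx : x ∈ A) (hy : y ∈ A) : g x = g y := by
  have hint : ∀ x ∈ A, ∃ n : ℤ, g x = n * (2 * Real.pi) := fun x hx => by
    simpa [Circle.exp_eq_one] using h1 x hx
  have key : ∀ x ∈ A, ∀ y ∈ A, ¬ g x < g y := by
    intro x hx y hy hlt
    obtain ⟨n, hn⟩ := hint x hx
    obtain ⟨m, hm⟩ := hint y hy
    have hpi := Real.pi_pos
    have hnm : n < m := by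
      rw [hn, hm] at hlt
      exact_mod_cast lt_of_mul_lt_mul_right hlt (by positivity)
    have hnm' : (n : ℝ) + 1 ≤ m := by exact_mod_cast hnm
    obtain ⟨z, hz, hzg⟩ := (hA.image g hg).ordConnected.out (Set.mem_image_of_mem g hx)
      (Set.mem_image_of_mem g hy) (show (n + 1 / 2) * (2 * Real.pi) ∈ Set.Icc (g x) (g y) by
        rw [hn, hm]; constructor <;> nlinarith)
    obtain ⟨k, hk⟩ := hint z hz
    rw [hk] at hzg
    have h2 : (k : ℝ) = n + 1 / 2 := mul_right_cancel₀ (by positivity) hzg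
    have h3 : ((2 * k : ℤ) : ℝ) = ((2 * n + 1 : ℤ) : ℝ) := by push_cast; linarith
    have h4 : 2 * k = 2 * n + 1 := by exact_mod_cast h3
    omega
  exact le_antisymm (not_lt.mp (key y hy x hx)) (not_lt.mp (key x hx y hy))

/-- Retracts of the plane are unicoherent. -/
lemma isPreconnected_inter_of_retract {π : ℝ × ℝ → ℝ × ℝ} (hπ : Continuous π)
    {A B : Set (ℝ × ℝ)} (hA : IsClosed A) (hB : IsClosed B) (hmem : ∀ p, π p ∈ A ∪ B)
    (hid : ∀ p ∈ A ∪ B, π p = p) (hAc : IsPreconnected A) (hBc : IsPreconnected B) :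
    IsPreconnected (A ∩ B) := by
  classical
  rw [isPreconnected_closed_iff]
  rintro t t' ht ht' hcov ⟨x, hx⟩ ⟨y, hy⟩
  by_contra hemp
  rw [Set.not_nonempty_iff_eq_empty] at hemp
  obtain ⟨φ, hφ0, hφ1, -⟩ := exists_continuous_zero_one_of_isClosed
    ((hA.inter hB).inter ht) ((hA.inter hB).inter ht') (by
      rw [Set.disjoint_iff_inter_eq_empty, ← hemp]; ext z; simp; tauto)
  have hφ : ∀ z ∈ A ∩ B, φ z = 0 ∨ φ z = 1 := fun z hz =>
    (hcov hz).imp (fun h => hφ0 ⟨hz, h⟩) (fun h => hφ1 ⟨hz, h⟩)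
  let c : ℝ × ℝ → Circle := fun z =>
    if π z ∈ A then Circle.exp (Real.pi * φ (π z)) else Circle.exp (2 * Real.pi - Real.pi * φ (π z))
  have hcA : ∀ z, π z ∈ A → c z = Circle.exp (Real.pi * φ (π z)) := fun z hz => if_pos hz
  have hcB : ∀ z, π z ∈ B → c z = Circle.exp (2 * Real.pi - Real.pi * φ (π z)) := by
    intro z hz
    by_cases hzA : π z ∈ A
    · rw [hcA z hzA]
      rcases hφ _ ⟨hzA, hz⟩ with h | h
      · simp [h]
      · rw [h]; congr 1; ring
    · exact if_neg hzA
  have hc : Continuous c := by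
    rw [← continuousOn_univ, show (Set.univ : Set (ℝ × ℝ)) = π ⁻¹' A ∪ π ⁻¹' B from
      (Set.eq_univ_of_forall fun p => hmem p).symm]
    refine ContinuousOn.union_of_isClosed ?_ ?_ (hA.preimage hπ) (hB.preimage hπ)
    · exact (Continuous.continuousOn (by fun_prop)).congr hcA
    · exact (Continuous.continuousOn (by fun_prop)).congr hcB
  obtain ⟨F, hF, hFc⟩ := exists_circle_lift hc
  have e1 : F x - Real.pi * φ x = F y - Real.pi * φ y := by
    refine hAc.eq_of_circle_exp_eq_one (g := fun z => F z - Real.pi * φ z)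
      (by fun_prop) (fun z hz => ?_) hx.1.1 hy.1.1
    have := hcA z (by rwa [hid z (Or.inl hz)])
    rw [hid z (Or.inl hz)] at this
    rw [Circle.exp_sub, hFc, this, div_self']
  have e2 : F x - (2 * Real.pi - Real.pi * φ x) = F y - (2 * Real.pi - Real.pi * φ y) := by
    refine hBc.eq_of_circle_exp_eq_one (g := fun z => F z - (2 * Real.pi - Real.pi * φ z))
      (by fun_prop) (fun z hz => ?_) hx.1.2 hy.1.2
    have := hcB z (by rwa [hid z (Or.inr hz)])
    rw [hid z (Or.inr hz)] at this
    rw [Circle.exp_sub (F z), hFc, this, div_self']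
  have f1 : φ x = 0 := hφ0 hx
  have f2 : φ y = 1 := hφ1 hy
  rw [f1, f2] at e1 e2
  linarith [Real.pi_pos]

lemma exists_polar_lift {v : ℝ × ℝ → ℝ × ℝ} (hv : Continuous v) (h0 : ∀ x, v x ≠ 0) :
    ∃ F R : ℝ × ℝ → ℝ, Continuous F ∧ (∀ x, 0 < R x) ∧
      ∀ x, v x = (R x * Real.cos (F x), R x * Real.sin (F x)) := by
  let z : ℝ × ℝ → ℂ := fun x => ⟨(v x).1, (v x).2⟩
  have hz : Continuous z := by
    have : z = fun x => Complex.equivRealProdCLM.symm (v x) := rfl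
    rw [this]; fun_prop
  have hz0 : ∀ x, z x ≠ 0 := fun x h => h0 x (by
    ext
    · exact congrArg Complex.re h
    · exact congrArg Complex.im h)
  let c : ℝ × ℝ → Circle := fun x => ⟨z x / ‖z x‖, by
    rw [Submonoid.unitSphere]; simp [hz0 x]⟩
  have hc : Continuous c := by
    refine Continuous.subtype_mk (hz.div (by fun_prop) fun x => ?_) _
    exact_mod_cast norm_ne_zero_iff.mpr (hz0 x)
  obtain ⟨F, hF, hFc⟩ := exists_circle_lift hc
  refine ⟨F, fun x => ‖z x‖, hF, fun x => norm_pos_iff.mpr (hz0 x), fun x => ?_⟩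
  have h1 : (Circle.exp (F x) : ℂ) = z x / ‖z x‖ := congrArg Subtype.val (hFc x)
  have hn : (‖z x‖ : ℂ) ≠ 0 := by exact_mod_cast norm_ne_zero_iff.mpr (hz0 x)
  rw [Circle.coe_exp, eq_div_iff hn, mul_comm, Complex.exp_mul_I] at h1
  ext
  · have := congrArg Complex.re h1
    simpa [Complex.cos_ofReal_re, Complex.sin_ofReal_im] using this.symm
  · have := congrArg Complex.im h1
    simpa [Complex.cos_ofReal_im, Complex.sin_ofReal_re] using this.symm

lemma angle_change {F : ℝ → ℝ} (hF : Continuous F) {γ x₀ x₁ : ℝ}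
    (hpos : ∀ s ∈ Set.Icc (0 : ℝ) 1, 0 < Real.cos (F s - γ))
    (h0 : Real.sin (F 0 - (γ + x₀)) = 0) (h1 : Real.sin (F 1 - (γ + x₁)) = 0)
    (hx₀ : |x₀| < Real.pi / 2) (hx₁ : |x₁| < Real.pi / 2) : F 1 - F 0 = x₁ - x₀ := by
  have hpi := Real.pi_pos
  have key : ∀ y x : ℝ, 0 < Real.cos (y - γ) → Real.sin (y - (γ + x)) = 0 → |x| < Real.pi / 2 →
      ∃ n : ℤ, y - γ = x + n * (2 * Real.pi) := by
    intro y x hy hs hx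
    obtain ⟨k, hk⟩ := Real.sin_eq_zero_iff.mp hs
    have hyx : y - γ = x + k * Real.pi := by linarith
    have hcx : 0 < Real.cos x := Real.cos_pos_of_mem_Ioo (abs_lt.mp hx |>.imp (by intro; linarith) id)
    rw [hyx, Real.cos_add_int_mul_pi] at hy
    rcases Int.even_or_odd k with ⟨n, hn⟩ | hodd
    · refine ⟨n, ?_⟩
      rw [hyx, hn]; push_cast; ring
    · rw [hodd.neg_one_zpow] at hy
      linarith
  obtain ⟨n, hn⟩ := key _ _ (hpos 0 (by simp)) h0 hx₀
  obtain ⟨m, hm⟩ := key _ _ (hpos 1 (by simp)) h1 hx₁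
  rw [abs_lt] at hx₀ hx₁
  have hbad : ∀ k : ℤ, ∀ s ∈ Set.Icc (0 : ℝ) 1, F s ≠ γ + (Real.pi / 2 + k * (2 * Real.pi)) := by
    intro k s hs h
    have := hpos s hs
    rw [h, add_sub_cancel_left, Real.cos_add_int_mul_two_pi, Real.cos_pi_div_two] at this
    exact this.ne rfl
  have hnm : n = m := by
    rcases lt_trichotomy n m with h | h | h
    · exfalso
      have h' : (n : ℝ) + 1 ≤ m := by exact_mod_cast h
      have : (γ + (Real.pi / 2 + n * (2 * Real.pi))) ∈ Set.Icc (F 0) (F 1) := by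
        constructor <;> nlinarith
      obtain ⟨s, hs, hs'⟩ := intermediate_value_Icc zero_le_one hF.continuousOn this
      exact hbad n s hs hs'
    · exact h
    · exfalso
      have h' : (m : ℝ) + 1 ≤ n := by exact_mod_cast h
      have : (γ + (Real.pi / 2 + m * (2 * Real.pi))) ∈ Set.Icc (F 1) (F 0) := by
        constructor <;> nlinarith
      obtain ⟨s, hs, hs'⟩ := intermediate_value_Icc' zero_le_one hF.continuousOn this
      exact hbad m s hs hs'
  subst hnm
  linarith

/-- The point at angle `θ` on the circle of radius `ρ`. -/
noncomputable def circlePoint (ρ θ : ℝ) : ℝ × ℝ := (ρ * Real.cos θ, ρ * Real.sin θ)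

lemma sin_sub_eq_zero_of_chord {ρ α β φ F R : ℝ} (hR : 0 < R)
    (hv : circlePoint ρ α - circlePoint ρ β = (R * Real.cos F, R * Real.sin F))
    (hφ : Real.cos ((α + β) / 2 - φ) = 0) : Real.sin (F - φ) = 0 := by
  have h1 : ρ * Real.cos α - ρ * Real.cos β = R * Real.cos F := congrArg Prod.fst hv
  have h2 : ρ * Real.sin α - ρ * Real.sin β = R * Real.sin F := congrArg Prod.snd hv
  have h3 : R * Real.sin (F - φ) = ρ * (Real.sin (α - φ) - Real.sin (β - φ)) := by
    rw [Real.sin_sub, Real.sin_sub, Real.sin_sub]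
    linear_combination Real.sin φ * h1 - Real.cos φ * h2
  rw [Real.sin_sub_sin, show ((α - φ) + (β - φ)) / 2 = (α + β) / 2 - φ by ring, hφ, mul_zero,
    mul_zero] at h3
  exact (mul_eq_zero.mp h3).resolve_left hR.ne'

lemma dot_lt_of_mem_euclBall {ρ θ : ℝ} {p : ℝ × ℝ} (hρ : 0 < ρ) (hp : p ∈ euclBall ρ)
    (hne : p ≠ circlePoint ρ θ) : p.1 * Real.cos θ + p.2 * Real.sin θ < ρ := by
  have hp' : p.1 ^ 2 + p.2 ^ 2 ≤ ρ ^ 2 := hp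
  have hcs := Real.sin_sq_add_cos_sq θ
  have : 0 < (p.1 - ρ * Real.cos θ) ^ 2 + (p.2 - ρ * Real.sin θ) ^ 2 := by
    rcases eq_or_ne p.1 (ρ * Real.cos θ) with h | h
    · have h2 : p.2 ≠ ρ * Real.sin θ := fun h2 => hne (Prod.ext h h2)
      have := sq_pos_of_ne_zero (sub_ne_zero.mpr h2)
      positivity
    · have := sq_pos_of_ne_zero (sub_ne_zero.mpr h)
      positivity
  have h2 : 0 < ρ * (ρ - (p.1 * Real.cos θ + p.2 * Real.sin θ)) := by nlinarith
  linarith [(mul_pos_iff_of_pos_left hρ).mp h2]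

lemma cos_pos_of_sub_circlePoint {ρ β F R : ℝ} {p : ℝ × ℝ} (hρ : 0 < ρ) (hR : 0 < R)
    (hp : p ∈ euclBall ρ) (hne : p ≠ circlePoint ρ β)
    (hv : p - circlePoint ρ β = (R * Real.cos F, R * Real.sin F)) :
    0 < Real.cos (F - (β + Real.pi)) := by
  have h1 : p.1 - ρ * Real.cos β = R * Real.cos F := congrArg Prod.fst hv
  have h2 : p.2 - ρ * Real.sin β = R * Real.sin F := congrArg Prod.snd hv
  have h3 := dot_lt_of_mem_euclBall hρ hp hne
  have hcs := Real.sin_sq_add_cos_sq β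
  have h4 : R * Real.cos (F - (β + Real.pi)) = ρ - (p.1 * Real.cos β + p.2 * Real.sin β) := by
    rw [← sub_sub, Real.cos_sub_pi, Real.cos_sub]
    linear_combination Real.cos β * h1 + Real.sin β * h2 + ρ * hcs
  exact (mul_pos_iff_of_pos_left hR).mp (by rw [h4]; linarith)

lemma cos_pos_of_circlePoint_sub {ρ α F R : ℝ} {p : ℝ × ℝ} (hρ : 0 < ρ) (hR : 0 < R)
    (hp : p ∈ euclBall ρ) (hne : p ≠ circlePoint ρ α)
    (hv : circlePoint ρ α - p = (R * Real.cos F, R * Real.sin F)) :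
    0 < Real.cos (F - α) := by
  have h1 : ρ * Real.cos α - p.1 = R * Real.cos F := congrArg Prod.fst hv
  have h2 : ρ * Real.sin α - p.2 = R * Real.sin F := congrArg Prod.snd hv
  have h3 := dot_lt_of_mem_euclBall hρ hp hne
  have hcs := Real.sin_sq_add_cos_sq α
  have h4 : R * Real.cos (F - α) = ρ - (p.1 * Real.cos α + p.2 * Real.sin α) := by
    rw [Real.cos_sub]
    linear_combination -Real.cos α * h1 - Real.sin α * h2 + ρ * hcs
  exact (mul_pos_iff_of_pos_left hR).mp (by rw [h4]; linarith)

/-- Two paths in a disc joining interlaced pairs of boundary points intersect. -/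
lemma exists_crossing {ρ α β α' β' : ℝ} (hρ : 0 < ρ) (h1 : α < β) (h2 : β < α') (h3 : α' < β')
    (h4 : β' < α + 2 * Real.pi) {K L : ℝ → ℝ × ℝ} (hK : Continuous K) (hL : Continuous L)
    (hKB : ∀ s, K s ∈ euclBall ρ) (hLB : ∀ s, L s ∈ euclBall ρ)
    (hK0 : K 0 = circlePoint ρ α) (hK1 : K 1 = circlePoint ρ α')
    (hL0 : L 0 = circlePoint ρ β) (hL1 : L 1 = circlePoint ρ β') : ∃ s t, K s = L t := by
  by_contra! hne
  obtain ⟨F, R, hF, hR, hv⟩ := exists_polar_lift (v := fun x => K x.1 - L x.2) (by fun_prop)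
    (fun x => sub_ne_zero.mpr (hne _ _))
  have hpi := Real.pi_pos
  have c1 : ∀ x y : ℝ, y = x + Real.pi / 2 → Real.cos (x - y) = 0 := fun x y h => by
    rw [h, sub_add_cancel_left, Real.cos_neg, Real.cos_pi_div_two]
  have c2 : ∀ x y : ℝ, y = x - Real.pi / 2 → Real.cos (x - y) = 0 := fun x y h => by
    rw [h, sub_sub_cancel, Real.cos_pi_div_two]
  have c3 : ∀ x y : ℝ, y = x + 3 * Real.pi / 2 → Real.cos (x - y) = 0 := fun x y h => by
    rw [show x - y = Real.pi / 2 - 2 * Real.pi by rw [h]; ring, Real.cos_sub_two_pi,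
      Real.cos_pi_div_two]
  have v00 := hv (0, 0)
  have v01 := hv (0, 1)
  have v10 := hv (1, 0)
  have v11 := hv (1, 1)
  simp only [hK0, hK1, hL0, hL1] at v00 v01 v10 v11
  have bot := angle_change (F := fun s => F (s, 0)) (by fun_prop) (γ := β + Real.pi)
    (x₀ := (α - β) / 2 + Real.pi / 2) (x₁ := (α' - β) / 2 - Real.pi / 2)
    (fun s _ => cos_pos_of_sub_circlePoint hρ (hR (s, 0)) (hKB s) (by rw [← hL0]; exact hne s 0)
      (by rw [← hL0]; exact hv (s, 0)))
    (sin_sub_eq_zero_of_chord (hR _) v00 (c3 _ _ (by ring)))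
    (sin_sub_eq_zero_of_chord (hR _) v10 (c1 _ _ (by ring)))
    (by rw [abs_lt]; constructor <;> linarith) (by rw [abs_lt]; constructor <;> linarith)
  have top := angle_change (F := fun s => F (s, 1)) (by fun_prop) (γ := β' + Real.pi)
    (x₀ := (α - β') / 2 + Real.pi / 2) (x₁ := (α' - β') / 2 + Real.pi / 2)
    (fun s _ => cos_pos_of_sub_circlePoint hρ (hR (s, 1)) (hKB s) (by rw [← hL1]; exact hne s 1)
      (by rw [← hL1]; exact hv (s, 1)))
    (sin_sub_eq_zero_of_chord (hR _) v01 (c3 _ _ (by ring)))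
    (sin_sub_eq_zero_of_chord (hR _) v11 (c3 _ _ (by ring)))
    (by rw [abs_lt]; constructor <;> linarith) (by rw [abs_lt]; constructor <;> linarith)
  have right := angle_change (F := fun t => F (1, t)) (by fun_prop) (γ := α')
    (x₀ := (β - α') / 2 + Real.pi / 2) (x₁ := (β' - α') / 2 - Real.pi / 2)
    (fun t _ => cos_pos_of_circlePoint_sub hρ (hR (1, t)) (hLB t)
      (by rw [← hK1]; exact (hne 1 t).symm) (by rw [← hK1]; exact hv (1, t)))
    (sin_sub_eq_zero_of_chord (hR _) v10 (c1 _ _ (by ring)))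
    (sin_sub_eq_zero_of_chord (hR _) v11 (c2 _ _ (by ring)))
    (by rw [abs_lt]; constructor <;> linarith) (by rw [abs_lt]; constructor <;> linarith)
  have left := angle_change (F := fun t => F (0, t)) (by fun_prop) (γ := α)
    (x₀ := (β - α) / 2 - Real.pi / 2) (x₁ := (β' - α) / 2 - Real.pi / 2)
    (fun t _ => cos_pos_of_circlePoint_sub hρ (hR (0, t)) (hLB t)
      (by rw [← hK0]; exact (hne 0 t).symm) (by rw [← hK0]; exact hv (0, t)))
    (sin_sub_eq_zero_of_chord (hR _) v00 (c2 _ _ (by ring)))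
    (sin_sub_eq_zero_of_chord (hR _) v01 (c2 _ _ (by ring)))
    (by rw [abs_lt]; constructor <;> linarith) (by rw [abs_lt]; constructor <;> linarith)
  linarith

lemma HasDerivAt.eventually_lt_right {f : ℝ → ℝ} {a c : ℝ} (hf : HasDerivAt f c a) (hc : 0 < c) :
    ∀ᶠ t in 𝓝[>] a, f a < f t := by
  have h := (hasDerivAt_iff_tendsto_slope.mp hf).eventually_const_lt hc
  filter_upwards [h.filter_mono (nhdsWithin_mono a fun x (hx : a < x) => hx.ne'),
    self_mem_nhdsWithin] with t ht hat
  rw [slope_def_field] at ht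
  linarith [(div_pos_iff_of_pos_right (sub_pos.mpr hat)).mp ht]

lemma HasDerivAt.eventually_lt_left {f : ℝ → ℝ} {a c : ℝ} (hf : HasDerivAt f c a) (hc : 0 < c) :
    ∀ᶠ t in 𝓝[<] a, f t < f a := by
  have h := (hasDerivAt_iff_tendsto_slope.mp hf).eventually_const_lt hc
  filter_upwards [h.filter_mono (nhdsWithin_mono a fun x (hx : x < a) => hx.ne),
    self_mem_nhdsWithin] with t ht hat
  rw [slope_def_field] at ht
  by_contra! hcon
  exact absurd ht (not_lt.mpr (div_nonpos_of_nonneg_of_nonpos (by linarith)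
    (sub_nonpos.mpr (le_of_lt hat))))

lemma mem_euclBall {ρ : ℝ} {p : ℝ × ℝ} : p ∈ euclBall ρ ↔ p.1 ^ 2 + p.2 ^ 2 ≤ ρ ^ 2 := Iff.rfl

lemma zero_mem_euclBall (ρ : ℝ) : (0 : ℝ × ℝ) ∈ euclBall ρ := by
  simpa [mem_euclBall] using sq_nonneg ρ

lemma sq_add_sq_pos_of_ne_zero {p : ℝ × ℝ} (hp : p ≠ 0) : 0 < p.1 ^ 2 + p.2 ^ 2 := by
  by_contra! h
  exact hp (Prod.ext (by simp; nlinarith [sq_nonneg p.1, sq_nonneg p.2])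
    (by simp; nlinarith [sq_nonneg p.1, sq_nonneg p.2]))

lemma isClosed_euclBall (ρ : ℝ) : IsClosed (euclBall ρ) :=
  isClosed_le (by fun_prop) continuous_const

lemma euclCircle_subset_euclBall (ρ : ℝ) : euclCircle ρ ⊆ euclBall ρ := fun _ hp => le_of_eq hp

lemma isCompact_euclBall (ρ : ℝ) : IsCompact (euclBall ρ) := by
  refine (isCompact_Icc (a := ((-|ρ|, -|ρ|) : ℝ × ℝ)) (b := (|ρ|, |ρ|))).of_isClosed_subset
    (isClosed_euclBall ρ) fun p hp => ?_
  rw [mem_euclBall] at hp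
  have h1 := abs_le.mp (sq_le_sq.mp (show p.1 ^ 2 ≤ ρ ^ 2 by nlinarith [sq_nonneg p.2]))
  have h2 := abs_le.mp (sq_le_sq.mp (show p.2 ^ 2 ≤ ρ ^ 2 by nlinarith [sq_nonneg p.1]))
  exact ⟨⟨h1.1, h2.1⟩, ⟨h1.2, h2.2⟩⟩

lemma convex_euclBall (ρ : ℝ) : Convex ℝ (euclBall ρ) := by
  intro p hp q hq a b ha hb hab
  rw [mem_euclBall] at hp hq ⊢
  simp only [Prod.fst_add, Prod.smul_fst, smul_eq_mul, Prod.snd_add, Prod.smul_snd]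
  have hb' : b = 1 - a := by linarith
  subst hb'
  nlinarith [mul_nonneg (mul_nonneg ha hb) (sq_nonneg (p.1 - q.1)),
    mul_nonneg (mul_nonneg ha hb) (sq_nonneg (p.2 - q.2)), mul_le_mul_of_nonneg_left hp ha,
    mul_le_mul_of_nonneg_left hq hb]

/-- The radial retraction of the plane onto the ball of radius `ρ`. -/
noncomputable def ballRetract (ρ : ℝ) (p : ℝ × ℝ) : ℝ × ℝ :=
  (ρ / max ρ √(p.1 ^ 2 + p.2 ^ 2)) • p

lemma continuous_ballRetract {ρ : ℝ} (hρ : 0 < ρ) : Continuous (ballRetract ρ) := by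
  unfold ballRetract
  have hm : Continuous fun p : ℝ × ℝ => max ρ √(p.1 ^ 2 + p.2 ^ 2) := by fun_prop
  exact (continuous_const.div hm fun p => (lt_max_of_lt_left hρ).ne').smul continuous_id

lemma ballRetract_of_mem {ρ : ℝ} (hρ : 0 < ρ) {p : ℝ × ℝ} (hp : p ∈ euclBall ρ) :
    ballRetract ρ p = p := by
  rw [ballRetract, max_eq_left (Real.sqrt_le_iff.mpr ⟨hρ.le, hp⟩), div_self hρ.ne', one_smul]

lemma ballRetract_mem {ρ : ℝ} (hρ : 0 < ρ) (p : ℝ × ℝ) : ballRetract ρ p ∈ euclBall ρ := by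
  have hm : 0 < max ρ √(p.1 ^ 2 + p.2 ^ 2) := lt_max_of_lt_left hρ
  have h1 : p.1 ^ 2 + p.2 ^ 2 ≤ (max ρ √(p.1 ^ 2 + p.2 ^ 2)) ^ 2 :=
    (Real.sqrt_le_left hm.le).mp (le_max_right _ _)
  rw [mem_euclBall, ballRetract]
  simp only [Prod.smul_fst, Prod.smul_snd, smul_eq_mul, mul_pow, ← mul_add, div_pow]
  rw [div_mul_eq_mul_div, div_le_iff₀ (by positivity)]
  gcongr

/-- The local properties of `H` on the ball of radius `ρ` on which the description of its
sectors relies. -/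
structure SectorRegular (H : ℝ × ℝ → ℝ) (ρ : ℝ) : Prop where
  pos : 0 < ρ
  analyticAt : ∀ p ∈ euclBall ρ, AnalyticAt ℝ H p
  radial : ∀ p ∈ euclBall ρ, p ≠ 0 → fderiv ℝ H p (-p.2, p.1) = 0 → 0 < H p * fderiv ℝ H p p
  map_zero : H 0 = 0
  not_isLocalMax : ¬ IsLocalMax H 0
  not_isLocalMin : ¬ IsLocalMin H 0

namespace SectorRegular

variable {H : ℝ × ℝ → ℝ} {ρ : ℝ}

lemma neg (hH : SectorRegular H ρ) : SectorRegular (-H) ρ where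
  pos := hH.pos
  analyticAt p hp := (hH.analyticAt p hp).neg
  radial p hp h0 h := by
    rw [fderiv_neg] at h ⊢
    simpa using hH.radial p hp h0 (by simpa using h)
  map_zero := by simp [hH.map_zero]
  not_isLocalMax h := hH.not_isLocalMin (by simpa using h.neg)
  not_isLocalMin h := hH.not_isLocalMax (by simpa using h.neg)

lemma continuousOn (hH : SectorRegular H ρ) : ContinuousOn H (euclBall ρ) :=
  fun p hp => (hH.analyticAt p hp).continuousAt.continuousWithinAt

lemma exists_direction (hH : SectorRegular H ρ) {p : ℝ × ℝ} (hp : p ∈ euclBall ρ) (hp0 : p ≠ 0)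
    (h : 0 ≤ H p) : ∃ v, 0 < fderiv ℝ H p v ∧ 0 < p.1 * v.1 + p.2 * v.2 := by
  have hpos := sq_add_sq_pos_of_ne_zero hp0
  by_cases hc : fderiv ℝ H p (-p.2, p.1) = 0
  · exact ⟨p, pos_of_mul_pos_right (hH.radial p hp hp0 hc) h, by nlinarith⟩
  · refine ⟨p + ((1 - fderiv ℝ H p p) / fderiv ℝ H p (-p.2, p.1)) • (-p.2, p.1), ?_, ?_⟩
    · rw [map_add, map_smul, smul_eq_mul, div_mul_cancel₀ _ hc]
      linarith
    · simp only [Prod.fst_add, Prod.smul_fst, smul_eq_mul, Prod.snd_add, Prod.smul_snd]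
      nlinarith

lemma hasDerivAt_line (hH : SectorRegular H ρ) {p : ℝ × ℝ} (hp : p ∈ euclBall ρ) (v : ℝ × ℝ) :
    HasDerivAt (fun t : ℝ => H (p + t • v)) (fderiv ℝ H p v) 0 := by
  have h1 : HasDerivAt (fun t : ℝ => p + t • v) v 0 := by
    simpa using ((hasDerivAt_id (0 : ℝ)).smul_const v).const_add p
  have h2 : HasFDerivAt H (fderiv ℝ H p) (p + (0 : ℝ) • v) := by
    simpa using (hH.analyticAt p hp).differentiableAt.hasFDerivAt
  exact h2.comp_hasDerivAt 0 h1

lemma _root_.hasDerivAt_sq_add_sq_line (p v : ℝ × ℝ) :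
    HasDerivAt (fun t : ℝ => (p + t • v).1 ^ 2 + (p + t • v).2 ^ 2)
      (2 * (p.1 * v.1 + p.2 * v.2)) 0 := by
  have h1 : ∀ a b : ℝ, HasDerivAt (fun t : ℝ => (a + t * b) ^ 2) (2 * (a * b)) 0 := fun a b => by
    have h := (((hasDerivAt_id (0 : ℝ)).mul_const b).const_add a).pow 2
    simp only [id, Nat.cast_ofNat, zero_mul, add_zero, one_mul] at h
    exact h.congr_deriv (by ring)
  exact ((h1 p.1 v.1).add (h1 p.2 v.2)).congr_deriv (by ring)

lemma _root_.tendsto_line (p v : ℝ × ℝ) : Tendsto (fun t : ℝ => p + t • v) (𝓝 0) (𝓝 p) :=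
  (show Continuous fun t : ℝ => p + t • v by fun_prop).tendsto' _ _ (by simp)

lemma frequently_inward (hH : SectorRegular H ρ) {p : ℝ × ℝ} (hp : p ∈ euclBall ρ) (hp0 : p ≠ 0)
    (h : 0 ≤ H p) : ∃ᶠ q in 𝓝 p, H q < H p ∧ q.1 ^ 2 + q.2 ^ 2 < p.1 ^ 2 + p.2 ^ 2 := by
  obtain ⟨v, hv1, hv2⟩ := hH.exists_direction hp hp0 h
  refine ((tendsto_line p v).mono_left (nhdsWithin_le_nhds (s := Set.Iio 0))).frequently
    (Eventually.frequently ?_)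
  filter_upwards [(hH.hasDerivAt_line hp v).eventually_lt_left hv1,
    (hasDerivAt_sq_add_sq_line p v).eventually_lt_left (by linarith)] with t h1 h2
  simp only [zero_smul, add_zero] at h1 h2
  exact ⟨h1, h2⟩

lemma frequently_outward (hH : SectorRegular H ρ) {p : ℝ × ℝ}
    (hp : p.1 ^ 2 + p.2 ^ 2 < ρ ^ 2) (hp0 : p ≠ 0) (h : 0 ≤ H p) :
    ∃ᶠ q in 𝓝 p, q ∈ euclBall ρ ∧ H p < H q ∧ p.1 ^ 2 + p.2 ^ 2 < q.1 ^ 2 + q.2 ^ 2 := by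
  obtain ⟨v, hv1, hv2⟩ := hH.exists_direction (le_of_lt hp : p ∈ euclBall ρ) hp0 h
  refine ((tendsto_line p v).mono_left (nhdsWithin_le_nhds (s := Set.Ioi 0))).frequently
    (Eventually.frequently ?_)
  have hcont : Continuous fun q : ℝ × ℝ => q.1 ^ 2 + q.2 ^ 2 := by fun_prop
  have hball : ∀ᶠ t in 𝓝[>] (0 : ℝ), p + t • v ∈ euclBall ρ :=
    ((tendsto_line p v).mono_left nhdsWithin_le_nhds).eventually
      ((hcont.continuousAt.eventually_lt_const hp).mono fun q hq => le_of_lt hq)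
  filter_upwards [hball, (hH.hasDerivAt_line (le_of_lt hp) v).eventually_lt_right hv1,
    (hasDerivAt_sq_add_sq_line p v).eventually_lt_right (by linarith)] with t h0 h1 h2
  simp only [zero_smul, add_zero] at h1 h2
  exact ⟨h0, h1, h2⟩

lemma _root_.frequently_radially_inward {p : ℝ × ℝ} (hp0 : p ≠ 0) :
    ∃ᶠ q in 𝓝 p, q.1 ^ 2 + q.2 ^ 2 < p.1 ^ 2 + p.2 ^ 2 := by
  refine ((tendsto_line p p).mono_left (nhdsWithin_le_nhds (s := Set.Iio 0))).frequently
    (Eventually.frequently ?_)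
  have hpos := sq_add_sq_pos_of_ne_zero hp0
  filter_upwards [(hasDerivAt_sq_add_sq_line p p).eventually_lt_left (by nlinarith)] with t h2
  simpa only [zero_smul, add_zero] using h2

/-- Every superlevel set in the ball at a positive level reaches the boundary circle. -/
lemma exists_circle_le (hH : SectorRegular H ρ) {Q : Set (ℝ × ℝ)} (hQ : IsCompact Q)
    (hQB : Q ⊆ euclBall ρ) (hQne : Q.Nonempty) (hpos : ∀ p ∈ Q, 0 < H p)
    (hout : ∀ p ∈ Q, ∀ᶠ q in 𝓝 p, q ∈ euclBall ρ → H p < H q → q ∈ Q) :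
    ∃ p ∈ Q, p ∈ euclCircle ρ := by
  obtain ⟨p, hp, hmax⟩ := hQ.exists_isMaxOn hQne
    (f := fun q : ℝ × ℝ => q.1 ^ 2 + q.2 ^ 2) (by fun_prop)
  refine ⟨p, hp, ?_⟩
  by_contra hcon
  have hlt : p.1 ^ 2 + p.2 ^ 2 < ρ ^ 2 := lt_of_le_of_ne (hQB hp) hcon
  have hp0 : p ≠ 0 := by
    rintro rfl
    exact (hpos 0 hp).ne' hH.map_zero
  obtain ⟨q, ⟨hq1, hq2, hq3⟩, hq4⟩ :=
    ((hH.frequently_outward hlt hp0 (hpos p hp).le).and_eventually (hout p hp)).exists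
  exact absurd (hmax (hq4 hq1 hq2)) (not_le.mpr hq3)

lemma exists_circle_pos (hH : SectorRegular H ρ) : ∃ p ∈ euclCircle ρ, 0 < H p := by
  have hball : euclBall ρ ∈ 𝓝 (0 : ℝ × ℝ) :=
    mem_of_superset ((isOpen_lt (f := fun q : ℝ × ℝ => q.1 ^ 2 + q.2 ^ 2) (g := fun _ => ρ ^ 2)
      (by fun_prop) continuous_const).mem_nhds (by simpa using pow_pos hH.pos 2))
      fun q hq => mem_euclBall.mpr (le_of_lt hq)
  obtain ⟨p₀, hp₀, hpB⟩ : ∃ p, 0 < H p ∧ p ∈ euclBall ρ := by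
    by_contra! h
    refine hH.not_isLocalMax ?_
    filter_upwards [hball] with q hq
    rw [hH.map_zero]
    exact not_lt.mp fun h' => h q h' hq
  obtain ⟨p, hp, hpC⟩ := hH.exists_circle_le (Q := euclBall ρ ∩ H ⁻¹' Set.Ici (H p₀))
    ((isCompact_euclBall ρ).of_isClosed_subset
      (hH.continuousOn.preimage_isClosed_of_isClosed (isClosed_euclBall ρ) isClosed_Ici)
      Set.inter_subset_left) Set.inter_subset_left ⟨p₀, hpB, le_refl (H p₀)⟩
    (fun p hp => hp₀.trans_le hp.2)
    (fun p hp => Eventually.of_forall fun q hq hlt => ⟨hq, le_trans hp.2 hlt.le⟩)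
  exact ⟨p, hpC, hp₀.trans_le hp.2⟩

end SectorRegular

lemma exists_superlevel_eq_Icc {f : ℝ → ℝ} (hf : ContDiff ℝ 1 f) {a b : ℝ} (hab : a < b)
    (ha : f a = 0) (hb : f b = 0) (ha' : deriv f a ≠ 0) (hb' : deriv f b ≠ 0)
    (hpos : ∀ t ∈ Set.Ioo a b, 0 < f t) :
    ∃ h₀ > 0, ∀ h ∈ Set.Ioo 0 h₀, ∃ α β, a < α ∧ α < β ∧ β < b ∧ ∀ t ∈ Set.Ioo a b,
      (h ≤ f t ↔ t ∈ Set.Icc α β) ∧ (f t = h ↔ t = α ∨ t = β) := by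
  have hd : ∀ t, HasDerivAt f (deriv f t) t := fun t =>
    (hf.differentiable (by norm_num) t).hasDerivAt
  have hdc : Continuous (deriv f) := hf.continuous_deriv le_rfl
  have ha0 : 0 < deriv f a := by
    by_contra! h
    obtain ⟨t, ht1, ht2⟩ := (((hd a).neg.eventually_lt_right
      (neg_pos.mpr (lt_of_le_of_ne h ha'))).and (Ioo_mem_nhdsGT hab)).exists
    have := hpos t ht2
    simp only [Pi.neg_apply, ha] at ht1
    linarith
  have hb0 : deriv f b < 0 := by
    by_contra! h
    obtain ⟨t, ht1, ht2⟩ := (((hd b).eventually_lt_left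
      (lt_of_le_of_ne h hb'.symm)).and (Ioo_mem_nhdsLT hab)).exists
    have := hpos t ht2
    rw [hb] at ht1
    linarith
  obtain ⟨ε₁, hε₁, h₁⟩ := Metric.eventually_nhds_iff.mp
    (hdc.continuousAt.eventually_const_lt ha0)
  obtain ⟨ε₂, hε₂, h₂⟩ := Metric.eventually_nhds_iff.mp
    (hdc.continuousAt.eventually_lt_const hb0)
  obtain ⟨ε, hε, hεlt⟩ : ∃ ε > 0, ε < min (min ε₁ ε₂) ((b - a) / 2) :=
    exists_between (lt_min (lt_min hε₁ hε₂) (by linarith))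
  obtain ⟨⟨hε1, hε2⟩, hε3⟩ : (ε < ε₁ ∧ ε < ε₂) ∧ ε < (b - a) / 2 := by
    simpa [lt_min_iff] using hεlt
  have hmono : StrictMonoOn f (Set.Icc a (a + ε)) :=
    strictMonoOn_of_deriv_pos (convex_Icc _ _) hf.continuous.continuousOn fun t ht => by
      rw [interior_Icc] at ht
      refine h₁ ?_
      rw [Real.dist_eq, abs_lt]
      constructor <;> linarith [ht.1, ht.2]
  have hanti : StrictAntiOn f (Set.Icc (b - ε) b) :=
    strictAntiOn_of_deriv_neg (convex_Icc _ _) hf.continuous.continuousOn fun t ht => by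
      rw [interior_Icc] at ht
      refine h₂ ?_
      rw [Real.dist_eq, abs_lt]
      constructor <;> linarith [ht.1, ht.2]
  have hmid : a + ε ≤ b - ε := by linarith
  obtain ⟨m, hm, hmin⟩ := (isCompact_Icc (a := a + ε) (b := b - ε)).exists_isMinOn
    (Set.nonempty_Icc.mpr hmid) hf.continuous.continuousOn
  have hmin' : ∀ t, a + ε ≤ t → t ≤ b - ε → f m ≤ f t := fun t h1 h2 => hmin ⟨h1, h2⟩
  refine ⟨f m, hpos m ⟨by linarith [hm.1], by linarith [hm.2]⟩, fun h hh => ?_⟩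
  obtain ⟨α, hα, hαh⟩ := intermediate_value_Icc (by linarith : a ≤ a + ε)
    hf.continuous.continuousOn (show h ∈ Set.Icc (f a) (f (a + ε)) from
      ⟨by linarith [hh.1], hh.2.le.trans (hmin' _ le_rfl hmid)⟩)
  obtain ⟨β, hβ, hβh⟩ := intermediate_value_Icc' (by linarith : b - ε ≤ b)
    hf.continuous.continuousOn (show h ∈ Set.Icc (f b) (f (b - ε)) from
      ⟨by linarith [hh.1], hh.2.le.trans (hmin' _ hmid le_rfl)⟩)
  have haα : a ≠ α := by rintro rfl; linarith [hh.1]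
  have hbβ : β ≠ b := by rintro rfl; linarith [hh.1]
  refine ⟨α, β, lt_of_le_of_ne hα.1 haα, by linarith [hα.2, hβ.1], lt_of_le_of_ne hβ.2 hbβ,
    fun t ht => ?_⟩
  rw [Set.mem_Icc]
  rcases le_or_gt t (a + ε) with h1 | h1
  · have ht' : t ∈ Set.Icc a (a + ε) := ⟨ht.1.le, h1⟩
    have htβ : t < β := by linarith [hβ.1]
    refine ⟨?_, ?_⟩
    · rw [← hαh, hmono.le_iff_le hα ht']
      exact ⟨fun h => ⟨h, htβ.le⟩, fun h => h.1⟩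
    · rw [← hαh, hmono.injOn.eq_iff ht' hα]
      exact ⟨Or.inl, fun h => h.resolve_right htβ.ne⟩
  rcases le_or_gt (b - ε) t with h2 | h2
  · have ht' : t ∈ Set.Icc (b - ε) b := ⟨h2, ht.2.le⟩
    have htα : α < t := by linarith [hα.2]
    refine ⟨?_, ?_⟩
    · rw [← hβh, hanti.le_iff_ge hβ ht']
      exact ⟨fun h => ⟨htα.le, h⟩, fun h => h.2⟩
    · rw [← hβh, hanti.injOn.eq_iff ht' hβ]
      exact ⟨Or.inr, fun h => h.resolve_left htα.ne'⟩
  · have hlt : h < f t := hh.2.trans_le (hmin' t h1.le h2.le)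
    have htα : α < t := by linarith [hα.2]
    have htβ : t < β := by linarith [hβ.1]
    exact ⟨⟨fun _ => ⟨htα.le, htβ.le⟩, fun _ => hlt.le⟩,
      ⟨fun h => absurd h hlt.ne', fun h => absurd h (by simp [htα.ne', htβ.ne])⟩⟩

lemma Function.Periodic.exists_pos_arc {f : ℝ → ℝ} {c : ℝ} (hper : Function.Periodic f c)
    (hc : 0 < c) (hf : Continuous f) {θ : ℝ} (hθ : 0 < f θ) (hneg : ∃ t, f t < 0) :
    ∃ a b, a < θ ∧ θ < b ∧ b < a + c ∧ f a = 0 ∧ f b = 0 ∧ ∀ t ∈ Set.Ioo a b, 0 < f t := by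
  obtain ⟨t₀, ht₀⟩ := hneg
  obtain ⟨t, ht, htf⟩ := hper.exists_mem_Ico hc t₀ (θ - c)
  rw [htf] at ht₀
  have htc : f (t + c) < 0 := by rwa [hper t]
  have hclosed : IsClosed {s | f s ≤ 0} := isClosed_le hf continuous_const
  have htθ : t ≤ θ := by linarith [ht.2]
  have hθt : θ ≤ t + c := by linarith [ht.1]
  obtain ⟨a, ⟨ha, haf⟩, hmax⟩ := ((isCompact_Icc (a := t) (b := θ)).inter_right
    hclosed).exists_isGreatest ⟨t, ⟨le_rfl, htθ⟩, ht₀.le⟩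
  obtain ⟨b, ⟨hb, hbf⟩, hmin⟩ := ((isCompact_Icc (a := θ) (b := t + c)).inter_right
    hclosed).exists_isLeast ⟨t + c, ⟨hθt, le_rfl⟩, htc.le⟩
  have ha0 : f a = 0 := by
    obtain ⟨s, hs, hs0⟩ := intermediate_value_Icc ha.2 hf.continuousOn (show 0 ∈ Set.Icc (f a) (f θ)
      from ⟨haf, hθ.le⟩)
    rwa [le_antisymm (hmax ⟨⟨ha.1.trans hs.1, hs.2⟩, hs0.le⟩) hs.1] at hs0
  have hb0 : f b = 0 := by
    obtain ⟨s, hs, hs0⟩ := intermediate_value_Icc' hb.1 hf.continuousOn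
      (show 0 ∈ Set.Icc (f b) (f θ) from ⟨hbf, hθ.le⟩)
    rwa [le_antisymm hs.2 (hmin ⟨⟨hs.1, hs.2.trans hb.2⟩, hs0.le⟩)] at hs0
  have haθ : a < θ := lt_of_le_of_ne ha.2 (by rintro rfl; exact hθ.ne' ha0)
  have hbθ : θ < b := lt_of_le_of_ne hb.1 (by rintro rfl; exact hθ.ne' hb0)
  have hta : t < a := lt_of_le_of_ne ha.1 (by rintro rfl; exact ht₀.ne ha0)
  refine ⟨a, b, haθ, hbθ, by linarith [hb.2], ha0, hb0, fun s hs => ?_⟩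
  by_contra! hcon
  rcases le_total s θ with h | h
  · exact absurd (hmax ⟨⟨hta.le.trans hs.1.le, h⟩, hcon⟩) (not_le.mpr hs.1)
  · exact absurd (hmin ⟨⟨h, hs.2.le.trans hb.2⟩, hcon⟩) (not_le.mpr hs.2)

lemma exists_curve_of_isPreconnected {V M : Set (ℝ × ℝ)} (hV : IsOpen V) (hM : IsPreconnected M)
    (hMV : M ⊆ V) {x y : ℝ × ℝ} (hx : x ∈ M) (hy : y ∈ M) :
    ∃ K : ℝ → ℝ × ℝ, Continuous K ∧ K 0 = x ∧ K 1 = y ∧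
      IsCompact (Set.range K) ∧ ∀ s, K s ∈ V := by
  have hconn : IsConnected (connectedComponentIn V x) :=
    isConnected_connectedComponentIn_iff.mpr (hMV hx)
  have hjoin : JoinedIn (connectedComponentIn V x) x y :=
    (hV.connectedComponentIn.isConnected_iff_isPathConnected.mp hconn).joinedIn _
      (mem_connectedComponentIn (hMV hx)) _ (hM.subset_connectedComponentIn hx hMV hy)
  refine ⟨hjoin.somePath.extend, hjoin.somePath.continuous_extend, hjoin.somePath.extend_zero,
    hjoin.somePath.extend_one, ?_, fun s => connectedComponentIn_subset _ _
      (hjoin.somePath_mem (Set.projIcc 0 1 zero_le_one s))⟩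
  rw [Path.extend_range]
  exact isCompact_range hjoin.somePath.continuous

section CirclePoint

variable {ρ : ℝ}

lemma circlePoint_mem (ρ θ : ℝ) : circlePoint ρ θ ∈ euclCircle ρ := by
  simp only [euclCircle, circlePoint, Set.mem_ofPred_eq]
  linear_combination ρ ^ 2 * Real.sin_sq_add_cos_sq θ

lemma circlePoint_periodic (ρ : ℝ) : Function.Periodic (circlePoint ρ) (2 * Real.pi) := fun θ => by
  simp [circlePoint]

lemma contDiff_circlePoint (ρ : ℝ) : ContDiff ℝ 1 (circlePoint ρ) :=
  (contDiff_const.mul Real.contDiff_cos).prodMk (contDiff_const.mul Real.contDiff_sin)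

lemma exists_eq_circlePoint (hρ : 0 < ρ) {p : ℝ × ℝ} (hp : p ∈ euclCircle ρ) (a : ℝ) :
    ∃ θ ∈ Set.Ico a (a + 2 * Real.pi), p = circlePoint ρ θ := by
  obtain ⟨θ, -, hθ⟩ := exists_polar p
  rw [show p.1 ^ 2 + p.2 ^ 2 = ρ ^ 2 from hp, Real.sqrt_sq hρ.le] at hθ
  obtain ⟨θ', hθ', h⟩ := (circlePoint_periodic ρ).exists_mem_Ico Real.two_pi_pos θ a
  exact ⟨θ', hθ', hθ.trans h⟩

lemma circlePoint_ne (hρ : 0 < ρ) {α β : ℝ} (h1 : α < β) (h2 : β < α + 2 * Real.pi) :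
    circlePoint ρ α ≠ circlePoint ρ β := by
  intro h
  have hc : Real.cos α = Real.cos β := mul_left_cancel₀ hρ.ne' (congrArg Prod.fst h)
  have hs : Real.sin α = Real.sin β := mul_left_cancel₀ hρ.ne' (congrArg Prod.snd h)
  have h3 : Real.cos (β - α) = 1 := by
    rw [Real.cos_sub, hc, hs]
    linear_combination Real.sin_sq_add_cos_sq β
  rw [Real.cos_eq_one_iff_of_lt_of_lt (by linarith [Real.two_pi_pos]) (by linarith)] at h3
  linarith

end CirclePoint

section Sector

variable {H : ℝ × ℝ → ℝ} {ρ : ℝ} {x₀ : ℝ × ℝ}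

lemma sector_subset_euclBall : sector H ρ x₀ ⊆ euclBall ρ := fun _ hp =>
  (connectedComponentIn_subset _ _ hp).1

lemma sector_neg : sector (-H) ρ x₀ = sector H ρ x₀ := by
  simp [sector]

lemma subset_sector_of_isPreconnected {A : Set (ℝ × ℝ)} (hA : IsPreconnected A)
    (hAB : ∀ q ∈ A, q ∈ euclBall ρ ∧ H q ≠ 0) {p : ℝ × ℝ} (hpA : p ∈ A)
    (hp : p ∈ sector H ρ x₀) : A ⊆ sector H ρ x₀ := by
  have h : sector H ρ x₀ = connectedComponentIn {p ∈ euclBall ρ | H p ≠ 0} p :=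
    connectedComponentIn_eq hp
  rw [h]
  exact hA.subset_connectedComponentIn hpA hAB

end Sector

namespace SectorRegular

variable {H : ℝ × ℝ → ℝ} {ρ : ℝ} {x₀ : ℝ × ℝ}

lemma pos_of_mem_sector (hH : SectorRegular H ρ) (hx₀ : x₀ ∈ euclBall ρ) (hx : 0 < H x₀)
    {p : ℝ × ℝ} (hp : p ∈ sector H ρ x₀) : 0 < H p := by
  by_contra! hcon
  obtain ⟨q, hq, hq0⟩ := isPreconnected_connectedComponentIn.intermediate_value hp
    (mem_connectedComponentIn (F := {p ∈ euclBall ρ | H p ≠ 0}) ⟨hx₀, hx.ne'⟩)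
    (hH.continuousOn.mono sector_subset_euclBall) (show (0 : ℝ) ∈ Set.Icc (H p) (H x₀) from
      ⟨hcon, hx.le⟩)
  exact (connectedComponentIn_subset _ _ hq).2 hq0

lemma eventually_mem_sector_iff (hH : SectorRegular H ρ) {p : ℝ × ℝ} (hp : p ∈ euclBall ρ)
    (hp0 : H p ≠ 0) : ∀ᶠ q in 𝓝 p, q ∈ euclBall ρ → (q ∈ sector H ρ x₀ ↔ p ∈ sector H ρ x₀) := by
  obtain ⟨ε, hε, hball⟩ := Metric.eventually_nhds_iff_ball.mp
    ((hH.analyticAt p hp).continuousAt.eventually_ne hp0)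
  have hpre : IsPreconnected (Metric.ball p ε ∩ euclBall ρ) :=
    ((convex_ball p ε).inter (convex_euclBall ρ)).isPreconnected
  have hsub : ∀ q ∈ Metric.ball p ε ∩ euclBall ρ, q ∈ euclBall ρ ∧ H q ≠ 0 := fun q hq =>
    ⟨hq.2, hball q hq.1⟩
  filter_upwards [Metric.ball_mem_nhds p hε] with q hq hqB
  exact ⟨fun h => subset_sector_of_isPreconnected hpre hsub ⟨hq, hqB⟩ h ⟨Metric.mem_ball_self hε, hp⟩,
    fun h => subset_sector_of_isPreconnected hpre hsub ⟨Metric.mem_ball_self hε, hp⟩ h ⟨hq, hqB⟩⟩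

lemma isClosed_superlevel (hH : SectorRegular H ρ) {h : ℝ} (hh : 0 < h) :
    IsClosed {p ∈ sector H ρ x₀ | h ≤ H p} := by
  refine isClosed_of_closure_subset fun p hp => ?_
  have hcl : IsClosed (euclBall ρ ∩ H ⁻¹' Set.Ici h) :=
    hH.continuousOn.preimage_isClosed_of_isClosed (isClosed_euclBall ρ) isClosed_Ici
  have hpB : p ∈ euclBall ρ ∩ H ⁻¹' Set.Ici h :=
    closure_minimal
      (Set.subset_inter (fun q hq => sector_subset_euclBall hq.1) fun q hq => hq.2) hcl hp
  obtain ⟨q, hq, hq'⟩ := ((mem_closure_iff_frequently.mp hp).and_eventually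
    (hH.eventually_mem_sector_iff (x₀ := x₀) hpB.1 (hh.trans_le hpB.2).ne')).exists
  exact ⟨(hq' (sector_subset_euclBall hq.1)).mp hq.1, hpB.2⟩

lemma isClosed_compl_superlevel (hH : SectorRegular H ρ) {h : ℝ} (hh : 0 < h) :
    IsClosed {p ∈ euclBall ρ | p ∈ sector H ρ x₀ → H p ≤ h} := by
  refine isClosed_of_closure_subset fun p hp => ?_
  have hpB : p ∈ euclBall ρ := closure_minimal (fun q hq => hq.1) (isClosed_euclBall ρ) hp
  refine ⟨hpB, fun hpS => ?_⟩
  by_contra! hlt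
  obtain ⟨q, hq, hq1, hq2⟩ := ((mem_closure_iff_frequently.mp hp).and_eventually
    ((hH.eventually_mem_sector_iff (x₀ := x₀) hpB (hh.trans hlt).ne').and
      ((hH.analyticAt p hpB).continuousAt.eventually_const_lt hlt))).exists
  exact absurd (hq.2 ((hq1 hq.1).mpr hpS)) (not_le.mpr hq2)

lemma isPreconnected_compl_superlevel (hH : SectorRegular H ρ) (hx₀ : x₀ ∈ euclBall ρ)
    (hx : 0 < H x₀) {h : ℝ} (hh : 0 < h) :
    IsPreconnected {p ∈ euclBall ρ | p ∈ sector H ρ x₀ → H p ≤ h} := by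
  refine IsPreconnected.of_descent (ν := fun p => p.1 ^ 2 + p.2 ^ 2) (T := {0})
    ((isCompact_euclBall ρ).of_isClosed_subset (hH.isClosed_compl_superlevel hh) fun p hp => hp.1)
    (by fun_prop) isPreconnected_singleton ?_ fun p hp hp0 => ?_
  · rintro _ rfl
    exact ⟨zero_mem_euclBall ρ, fun _ => hH.map_zero.trans_le hh.le⟩
  · by_cases hpS : p ∈ sector H ρ x₀
    · refine (hH.frequently_inward hp.1 hp0 (hH.pos_of_mem_sector hx₀ hx hpS).le).mono
        fun q hq => ⟨⟨hq.2.le.trans hp.1, fun _ => hq.1.le.trans (hp.2 hpS)⟩, hq.2⟩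
    · by_cases hz : H p = 0
      · have hev := (hH.analyticAt p hp.1).continuousAt.eventually_lt_const (hz.trans_lt hh)
        exact ((frequently_radially_inward hp0).and_eventually hev).mono fun q hq =>
          ⟨⟨hq.1.le.trans hp.1, fun _ => hq.2.le⟩, hq.1⟩
      · refine ((frequently_radially_inward hp0).and_eventually
          (hH.eventually_mem_sector_iff (x₀ := x₀) hp.1 hz)).mono fun q hq => ?_
        have hqB : q ∈ euclBall ρ := hq.1.le.trans hp.1
        exact ⟨⟨hqB, fun hqS => absurd ((hq.2 hqB).mp hqS) hpS⟩, hq.1⟩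

lemma isPreconnected_nonpos (hH : SectorRegular H ρ) :
    IsPreconnected (euclBall ρ ∩ H ⁻¹' Set.Iic 0) := by
  refine IsPreconnected.of_descent (ν := fun p => p.1 ^ 2 + p.2 ^ 2) (T := {0})
    ((isCompact_euclBall ρ).of_isClosed_subset
      (hH.continuousOn.preimage_isClosed_of_isClosed (isClosed_euclBall ρ) isClosed_Iic)
      Set.inter_subset_left)
    (by fun_prop) isPreconnected_singleton ?_ fun p hp hp0 => ?_
  · rintro _ rfl
    exact ⟨zero_mem_euclBall ρ, hH.map_zero.le⟩
  · rcases eq_or_lt_of_le (show H p ≤ 0 from hp.2) with hz | hz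
    · exact (hH.frequently_inward hp.1 hp0 hz.ge).mono fun q hq =>
        ⟨⟨hq.2.le.trans hp.1, (hq.1.trans_eq hz).le⟩, hq.2⟩
    · exact ((frequently_radially_inward hp0).and_eventually
        ((hH.analyticAt p hp.1).continuousAt.eventually_lt_const hz)).mono fun q hq =>
          ⟨⟨hq.1.le.trans hp.1, hq.2.le⟩, hq.1⟩

lemma isPreconnected_superlevel (hH : SectorRegular H ρ) {h : ℝ} (hh : 0 < h)
    (hT : IsPreconnected ({p ∈ sector H ρ x₀ | h ≤ H p} ∩ euclCircle ρ)) :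
    IsPreconnected {p ∈ sector H ρ x₀ | h ≤ H p} := by
  refine IsPreconnected.of_descent (ν := fun p => -(p.1 ^ 2 + p.2 ^ 2))
    ((isCompact_euclBall ρ).of_isClosed_subset (hH.isClosed_superlevel hh)
      fun p hp => sector_subset_euclBall hp.1)
    (by fun_prop) hT Set.inter_subset_left fun p hp hpT => ?_
  have hpB := sector_subset_euclBall hp.1
  have hlt : p.1 ^ 2 + p.2 ^ 2 < ρ ^ 2 := lt_of_le_of_ne hpB fun h => hpT ⟨hp, h⟩
  have hpos : 0 < H p := hh.trans_le hp.2
  have hp0 : p ≠ 0 := by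
    rintro rfl
    exact hpos.ne' hH.map_zero
  refine ((hH.frequently_outward hlt hp0 hpos.le).and_eventually
    (hH.eventually_mem_sector_iff (x₀ := x₀) hpB hpos.ne')).mono ?_
  rintro q ⟨⟨hq1, hq2, hq3⟩, hq4⟩
  exact ⟨⟨(hq4 hq1).mpr hp.1, hp.2.trans hq2.le⟩, neg_lt_neg hq3⟩

lemma exists_circle_mem_sector (hH : SectorRegular H ρ) (hx₀ : x₀ ∈ euclBall ρ)
    (hx : 0 < H x₀) : ∃ p ∈ sector H ρ x₀, p ∈ euclCircle ρ := by
  obtain ⟨p, hp, hpC⟩ := hH.exists_circle_le (Q := {p ∈ sector H ρ x₀ | H x₀ ≤ H p})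
    ((isCompact_euclBall ρ).of_isClosed_subset (hH.isClosed_superlevel hx)
      fun p hp => sector_subset_euclBall hp.1) (fun p hp => sector_subset_euclBall hp.1)
    ⟨x₀, mem_connectedComponentIn ⟨hx₀, hx.ne'⟩, le_rfl⟩ (fun p hp => hx.trans_le hp.2)
    (fun p hp => by
      filter_upwards [hH.eventually_mem_sector_iff (x₀ := x₀) (sector_subset_euclBall hp.1)
        (hx.trans_le hp.2).ne'] with q hq hqB hlt
      exact ⟨(hq hqB).mpr hp.1, hp.2.trans hlt.le⟩)
  exact ⟨p, hp.1, hpC⟩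

lemma continuous_comp_ballRetract (hH : SectorRegular H ρ) :
    Continuous fun p => H (ballRetract ρ p) :=
  hH.continuousOn.comp_continuous (continuous_ballRetract hH.pos) (ballRetract_mem hH.pos)

/-- Two points of a sector on the boundary circle are not separated by two points of the circle
where `H ≤ 0`. -/
lemma not_mem_sector_of_separated (hH : SectorRegular H ρ) (hx₀ : x₀ ∈ euclBall ρ)
    (hx : 0 < H x₀) {α β α' β' : ℝ} (h1 : α < β) (h2 : β < α') (h3 : α' < β')
    (h4 : β' < α + 2 * Real.pi) (hα : circlePoint ρ α ∈ sector H ρ x₀)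
    (hβ : H (circlePoint ρ β) ≤ 0) (hβ' : H (circlePoint ρ β') ≤ 0) :
    circlePoint ρ α' ∉ sector H ρ x₀ := by
  intro hα'
  have hB : ∀ θ, circlePoint ρ θ ∈ euclBall ρ := fun θ =>
    euclCircle_subset_euclBall ρ (circlePoint_mem ρ θ)
  have hπ := continuous_ballRetract hH.pos
  obtain ⟨K, hK, hK0, hK1, hKc, hKV⟩ := exists_curve_of_isPreconnected
    (V := {p | 0 < H (ballRetract ρ p)}) (M := sector H ρ x₀)
    (isOpen_lt continuous_const hH.continuous_comp_ballRetract) isPreconnected_connectedComponentIn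
    (fun p hp => by
      rw [Set.mem_ofPred_eq, ballRetract_of_mem hH.pos (sector_subset_euclBall hp)]
      exact hH.pos_of_mem_sector hx₀ hx hp) hα hα'
  have hcl : IsClosed (ballRetract ρ '' Set.range K) := (hKc.image hπ).isClosed
  obtain ⟨L, hL, hL0, hL1, -, hLV⟩ := exists_curve_of_isPreconnected
    (V := ballRetract ρ ⁻¹' (ballRetract ρ '' Set.range K)ᶜ) (hcl.isOpen_compl.preimage hπ)
    hH.isPreconnected_nonpos
    (fun p hp => by
      rintro ⟨_, ⟨s, rfl⟩, hs⟩
      have := hKV s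
      rw [Set.mem_ofPred_eq, hs, ballRetract_of_mem hH.pos hp.1] at this
      exact absurd hp.2 (not_le.mpr this)) ⟨hB β, hβ⟩ ⟨hB β', hβ'⟩
  obtain ⟨s, t, hst⟩ := exists_crossing hH.pos h1 h2 h3 h4 (hπ.comp hK) (hπ.comp hL)
    (fun s => ballRetract_mem hH.pos _) (fun s => ballRetract_mem hH.pos _)
    (by simp [hK0, ballRetract_of_mem hH.pos (hB α)])
    (by simp [hK1, ballRetract_of_mem hH.pos (hB α')])
    (by simp [hL0, ballRetract_of_mem hH.pos (hB β)])
    (by simp [hL1, ballRetract_of_mem hH.pos (hB β')])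
  exact hLV t ⟨K s, ⟨s, rfl⟩, hst⟩

/-- A sector meets the boundary circle in an open arc whose endpoints are zeros of `H`. -/
lemma exists_arc (hH : SectorRegular H ρ) (hx₀ : x₀ ∈ euclBall ρ) (hx : 0 < H x₀) :
    ∃ a b, a < b ∧ b < a + 2 * Real.pi ∧ H (circlePoint ρ a) = 0 ∧ H (circlePoint ρ b) = 0 ∧
      sector H ρ x₀ ∩ euclCircle ρ = circlePoint ρ '' Set.Ioo a b := by
  have hB : ∀ θ, circlePoint ρ θ ∈ euclBall ρ := fun θ =>
    euclCircle_subset_euclBall ρ (circlePoint_mem ρ θ)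
  have hcont : Continuous fun θ => H (circlePoint ρ θ) :=
    hH.continuousOn.comp_continuous (contDiff_circlePoint ρ).continuous hB
  obtain ⟨p, hpS, hpC⟩ := hH.exists_circle_mem_sector hx₀ hx
  obtain ⟨θ, -, rfl⟩ := exists_eq_circlePoint hH.pos hpC 0
  obtain ⟨q, hqC, hq⟩ := hH.neg.exists_circle_pos
  obtain ⟨φ, -, rfl⟩ := exists_eq_circlePoint hH.pos hqC 0
  obtain ⟨a, b, haθ, hθb, hab, ha, hb, hpos⟩ :=
    Function.Periodic.exists_pos_arc (f := fun θ => H (circlePoint ρ θ))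
      ((circlePoint_periodic ρ).comp H) Real.two_pi_pos hcont
      (hH.pos_of_mem_sector hx₀ hx hpS) ⟨φ, neg_pos.mp hq⟩
  refine ⟨a, b, haθ.trans hθb, hab, ha, hb, Set.Subset.antisymm ?_ ?_⟩
  · rintro p ⟨hp, hpC'⟩
    obtain ⟨α, hα, rfl⟩ := exists_eq_circlePoint hH.pos hpC' a
    have hαpos := hH.pos_of_mem_sector hx₀ hx hp
    have haα : a ≠ α := by
      rintro rfl
      exact hαpos.ne' ha
    have hbα : b ≠ α := by
      rintro rfl
      exact hαpos.ne' hb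
    refine ⟨α, ⟨lt_of_le_of_ne hα.1 haα, ?_⟩, rfl⟩
    by_contra! hcon
    exact hH.not_mem_sector_of_separated hx₀ hx hθb (lt_of_le_of_ne hcon hbα) hα.2
      (by linarith) hpS hb.le (by rw [circlePoint_periodic]; exact ha.le) hp
  · refine Set.subset_inter ?_ (Set.image_subset_iff.mpr fun t _ => circlePoint_mem ρ t)
    refine subset_sector_of_isPreconnected (isPreconnected_Ioo.image _
      (contDiff_circlePoint ρ).continuous.continuousOn) ?_ ⟨θ, ⟨haθ, hθb⟩, rfl⟩ hpS
    rintro _ ⟨t, ht, rfl⟩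
    exact ⟨hB t, (hpos t ht).ne'⟩

lemma contDiff_comp_circlePoint (hH : SectorRegular H ρ) :
    ContDiff ℝ 1 fun θ => H (circlePoint ρ θ) :=
  contDiff_iff_contDiffAt.mpr fun θ =>
    (hH.analyticAt _ (euclCircle_subset_euclBall ρ (circlePoint_mem ρ θ))).contDiffAt.comp θ
      (contDiff_circlePoint ρ).contDiffAt

lemma deriv_comp_circlePoint_ne_zero (hH : SectorRegular H ρ) {θ : ℝ}
    (h : H (circlePoint ρ θ) = 0) : deriv (fun θ => H (circlePoint ρ θ)) θ ≠ 0 := by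
  have hC := circlePoint_mem ρ θ
  have hB := euclCircle_subset_euclBall ρ hC
  have hd : HasDerivAt (circlePoint ρ) (-(circlePoint ρ θ).2, (circlePoint ρ θ).1) θ := by
    have h1 := ((Real.hasDerivAt_cos θ).const_mul ρ).prodMk ((Real.hasDerivAt_sin θ).const_mul ρ)
    rwa [mul_neg] at h1
  have hd' : HasDerivAt (fun θ => H (circlePoint ρ θ)) _ θ :=
    (hH.analyticAt _ hB).differentiableAt.hasFDerivAt.comp_hasDerivAt θ hd
  rw [hd'.deriv]
  intro h0
  have hne : circlePoint ρ θ ≠ 0 := by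
    intro hz
    rw [hz] at hC
    have : (0 : ℝ) = ρ ^ 2 := by simpa [euclCircle] using hC
    exact (pow_pos hH.pos 2).ne this
  have := hH.radial _ hB hne h0
  rw [h, zero_mul] at this
  exact lt_irrefl _ this

theorem level_sets_of_pos (hH : SectorRegular H ρ) (hx₀ : x₀ ∈ euclBall ρ) (hx : 0 < H x₀) :
    ∃ h₀ > (0 : ℝ), ∀ h ∈ Set.Ioo (0 : ℝ) h₀,
      IsConnected {p ∈ sector H ρ x₀ | |H p| = h} ∧
        ({p ∈ sector H ρ x₀ | |H p| = h} ∩ euclCircle ρ).ncard = 2 := by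
  obtain ⟨a, b, hab, hba, ha, hb, harc⟩ := hH.exists_arc hx₀ hx
  have hmem : ∀ t ∈ Set.Ioo a b, circlePoint ρ t ∈ sector H ρ x₀ ∩ euclCircle ρ := fun t ht => by
    rw [harc]
    exact Set.mem_image_of_mem _ ht
  obtain ⟨h₀, hh₀, hlev⟩ := exists_superlevel_eq_Icc hH.contDiff_comp_circlePoint hab ha hb
    (hH.deriv_comp_circlePoint_ne_zero ha) (hH.deriv_comp_circlePoint_ne_zero hb)
    fun t ht => hH.pos_of_mem_sector hx₀ hx (hmem t ht).1
  refine ⟨h₀, hh₀, fun h hh => ?_⟩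
  obtain ⟨α, β, haα, hαβ, hβb, hlev⟩ := hlev h hh
  have hα : α ∈ Set.Ioo a b := ⟨haα, hαβ.trans hβb⟩
  have hβ : β ∈ Set.Ioo a b := ⟨haα.trans hαβ, hβb⟩
  have habs : {p ∈ sector H ρ x₀ | |H p| = h} = {p ∈ sector H ρ x₀ | H p = h} := by
    ext p
    exact and_congr_right fun hp => by rw [abs_of_pos (hH.pos_of_mem_sector hx₀ hx hp)]
  have hcircle : {p ∈ sector H ρ x₀ | H p = h} ∩ euclCircle ρ =
      {circlePoint ρ α, circlePoint ρ β} := by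
    ext p
    constructor
    · rintro ⟨⟨hpS, hp⟩, hpC⟩
      obtain ⟨t, ht, rfl⟩ := harc.subset ⟨hpS, hpC⟩
      rcases (hlev t ht).2.mp hp with rfl | rfl
      · exact Or.inl rfl
      · exact Or.inr rfl
    · rintro (rfl | rfl)
      · exact ⟨⟨(hmem α hα).1, (hlev α hα).2.mpr (Or.inl rfl)⟩, (hmem α hα).2⟩
      · exact ⟨⟨(hmem β hβ).1, (hlev β hβ).2.mpr (Or.inr rfl)⟩, (hmem β hβ).2⟩
  have hsuper : {p ∈ sector H ρ x₀ | h ≤ H p} ∩ euclCircle ρ = circlePoint ρ '' Set.Icc α β := by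
    ext p
    constructor
    · rintro ⟨⟨hpS, hp⟩, hpC⟩
      obtain ⟨t, ht, rfl⟩ := harc.subset ⟨hpS, hpC⟩
      exact ⟨t, (hlev t ht).1.mp hp, rfl⟩
    · rintro ⟨t, ht, rfl⟩
      have ht' : t ∈ Set.Ioo a b := ⟨haα.trans_le ht.1, ht.2.trans_lt hβb⟩
      exact ⟨⟨(hmem t ht').1, (hlev t ht').1.mpr ht⟩, (hmem t ht').2⟩
  have hinter : {p ∈ sector H ρ x₀ | H p = h} = {p ∈ sector H ρ x₀ | h ≤ H p} ∩
      {p ∈ euclBall ρ | p ∈ sector H ρ x₀ → H p ≤ h} := by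
    ext p
    exact ⟨fun hp => ⟨⟨hp.1, hp.2.ge⟩, sector_subset_euclBall hp.1, fun _ => hp.2.le⟩,
      fun hp => ⟨hp.1.1, le_antisymm (hp.2.2 hp.1.1) hp.1.2⟩⟩
  have hunion : {p ∈ sector H ρ x₀ | h ≤ H p} ∪
      {p ∈ euclBall ρ | p ∈ sector H ρ x₀ → H p ≤ h} = euclBall ρ := by
    refine Set.Subset.antisymm (Set.union_subset (fun p hp => sector_subset_euclBall hp.1)
      fun p hp => hp.1) fun p hp => ?_
    by_cases hc : p ∈ sector H ρ x₀ ∧ h ≤ H p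
    · exact Or.inl hc
    · exact Or.inr ⟨hp, fun hpS => le_of_not_ge fun hle => hc ⟨hpS, hle⟩⟩
  rw [habs]
  refine ⟨⟨⟨circlePoint ρ α, (hcircle.superset (Or.inl rfl)).1⟩, ?_⟩, ?_⟩
  · rw [hinter]
    refine isPreconnected_inter_of_retract (continuous_ballRetract hH.pos)
      (hH.isClosed_superlevel hh.1) (hH.isClosed_compl_superlevel hh.1)
      (fun p => hunion.superset (ballRetract_mem hH.pos p))
      (fun p hp => ballRetract_of_mem hH.pos (hunion.subset hp))
      (hH.isPreconnected_superlevel hh.1 ?_) (hH.isPreconnected_compl_superlevel hx₀ hx hh.1)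
    rw [hsuper]
    exact isPreconnected_Icc.image _ (contDiff_circlePoint ρ).continuous.continuousOn
  · rw [hcircle]
    exact Set.ncard_pair (circlePoint_ne hH.pos hαβ (by linarith))

end SectorRegular

/-- Level sets in a separatrix sector: for all sufficiently small `ρ > 0` and every
separatrix sector `S` of `B_ρ ∖ {H = 0}`, there is `h₀ > 0` such that for every
`h ∈ (0, h₀)` the level set `{p ∈ S : |H p| = h}` is connected and intersects the
boundary circle `∂B_ρ` in exactly two points. -/
theorem level_sets_in_separatrix_sector (H : ℝ × ℝ → ℝ)
    (hH : AnalyticAt ℝ H 0) (h0 : H 0 = 0) (hcrit : fderiv ℝ H 0 = 0)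
    (hiso : ∀ᶠ p in nhds (0 : ℝ × ℝ), fderiv ℝ H p = 0 → p = 0)
    (hmax : ¬ IsLocalMax H 0) (hmin : ¬ IsLocalMin H 0) :
    ∃ ρ₀ > (0 : ℝ), ∀ ρ : ℝ, 0 < ρ → ρ < ρ₀ →
      ∀ x₀ ∈ {p ∈ euclBall ρ | H p ≠ 0},
        ∃ h₀ > (0 : ℝ), ∀ h ∈ Set.Ioo (0 : ℝ) h₀,
          IsConnected {p ∈ sector H ρ x₀ | |H p| = h} ∧
          ({p ∈ sector H ρ x₀ | |H p| = h} ∩ euclCircle ρ).ncard = 2 := by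
  obtain ⟨ρ₀, hρ₀, hreg⟩ := exists_radius_mul_fderiv_pos hH h0 hiso
  refine ⟨ρ₀, hρ₀, fun ρ hρ hlt x₀ hx₀ => ?_⟩
  have hB : ∀ p ∈ euclBall ρ, p.1 ^ 2 + p.2 ^ 2 < ρ₀ ^ 2 := fun p hp =>
    lt_of_le_of_lt hp (pow_lt_pow_left₀ hlt hρ.le two_ne_zero)
  have hS : SectorRegular H ρ :=
    ⟨hρ, fun p hp => (hreg p (hB p hp)).1, fun p hp => (hreg p (hB p hp)).2, h0, hmax, hmin⟩
  rcases lt_or_gt_of_ne hx₀.2 with hneg | hpos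
  · simpa [sector_neg] using hS.neg.level_sets_of_pos hx₀.1 (neg_pos.mpr hneg)
  · exact hS.level_sets_of_pos hx₀.1 hpos
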